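/- arXiv:1503.06291 — 2 statements merged into one kernel-verified Lean document; each statement's English description precedes it below -/
import Mathlib

section
/- Let η(ξ) = |ξ|²/(1+|ξ|²)² on ℝⁿ. For σ ∈ ℝ, s ∈ ℝ with σ + s > 0, r ∈ [1,∞], p ∈ [1,2], and ℓ > n(1/p − 1/2) (ℓ ≥ 0 if p = 2), any f ∈ Ḃ^{σ+ℓ}_{p,r}(ℝⁿ) ∩ Ḃ^{-s}_{2,∞}(ℝⁿ) satisfies ‖ 2^{qσ} ‖𝔉(Δ̇_q f) e^{-η(ξ)t}‖_{L²} ‖_{ℓ^r_q} ≲ (1+t)^{-(σ+s)/2} ‖f‖_{Ḃ^{-s}_{2,∞}} + (1+t)^{-ℓ/2 + (n/2)(1/p − 1/2)} ‖f‖_{Ḃ^{σ+ℓ}_{p,r}} for all t ≥ 0. -/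
open MeasureTheory Real ENNReal SchwartzMap
open scoped FourierTransform
noncomputable section

/-- A homogeneous Littlewood–Paley partition function on `ℝⁿ`:
smooth, supported in the annulus `3/4 ≤ |ξ| ≤ 8/3`, with
`Σ_{q∈ℤ} φ(2^{-q}ξ) = 1` for `ξ ≠ 0`. -/
structure IsLP {n : ℕ} (φ : EuclideanSpace ℝ (Fin n) → ℝ) : Prop where
  smooth : ContDiff ℝ (⊤ : ℕ∞) φ
  supp : ∀ ξ, φ ξ ≠ 0 → 3/4 ≤ ‖ξ‖ ∧ ‖ξ‖ ≤ 8/3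
  sum : ∀ ξ : EuclideanSpace ℝ (Fin n), ξ ≠ 0 →
    HasSum (fun q : ℤ => φ ((2:ℝ)^(-q) • ξ)) 1

/-- Homogeneous Littlewood–Paley block `Δ̇_q f = 𝓕⁻(φ(2^{-q}·) 𝓕f)`. -/
def blk {n : ℕ} (φ : EuclideanSpace ℝ (Fin n) → ℝ) (q : ℤ)
    (f : EuclideanSpace ℝ (Fin n) → ℂ) : EuclideanSpace ℝ (Fin n) → ℂ :=
  𝓕⁻ (fun ξ => (φ ((2:ℝ)^(-q) • ξ) : ℂ) * 𝓕 f ξ)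

/-- `ℓ^r` norm of a sequence indexed by `ℤ`. -/
def lpSeq (r : ℝ≥0∞) (a : ℤ → ℝ) : ℝ≥0∞ := eLpNorm a r Measure.count

/-- Homogeneous Besov norm `‖f‖_{Ḃ^s_{p,r}}`. -/
def besov {n : ℕ} (φ : EuclideanSpace ℝ (Fin n) → ℝ) (s : ℝ) (p r : ℝ≥0∞)
    (f : EuclideanSpace ℝ (Fin n) → ℂ) : ℝ≥0∞ :=
  lpSeq r (fun q => (2:ℝ) ^ ((q:ℝ) * s) * (eLpNorm (blk φ q f) p volume).toReal)

theorem exists_rpow_mul_exp_neg_le (a c : ℝ) (ha : 0 ≤ a) (hc : 0 < c) :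
    ∃ K : ℝ, 1 ≤ K ∧ ∀ z : ℝ, 0 ≤ z → z ^ a * Real.exp (-(c * z)) ≤ K := by
  obtain ⟨m, hm⟩ := exists_nat_ge a
  refine ⟨1 + m.factorial / c ^ m, le_add_of_nonneg_right (by positivity), fun z hz => ?_⟩
  have hfac : z ^ m ≤ m.factorial / c ^ m * Real.exp (c * z) := by
    have h := Real.pow_div_factorial_le_exp (c * z) (mul_nonneg hc.le hz) m
    rw [div_le_iff₀ (by positivity), mul_pow] at h
    rw [div_mul_eq_mul_div, le_div_iff₀ (by positivity)]
    linarith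
  have hpow : z ^ a ≤ 1 + z ^ m := by
    rcases le_total z 1 with h | h
    · exact (Real.rpow_le_one hz h ha).trans (le_add_of_nonneg_right (by positivity))
    · calc z ^ a ≤ z ^ (m : ℝ) := Real.rpow_le_rpow_of_exponent_le h hm
        _ = z ^ m := Real.rpow_natCast z m
        _ ≤ 1 + z ^ m := by linarith
  have hexp : 1 ≤ Real.exp (c * z) := Real.one_le_exp (by positivity)
  rw [Real.exp_neg, ← div_eq_mul_inv, div_le_iff₀ (Real.exp_pos _)]
  linarith

theorem exists_rpow_mul_exp_neg_le_two_rpow (b c : ℝ) (hb : 0 < b) (hc : 0 < c) :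
    ∃ K : ℝ, 1 ≤ K ∧ ∀ y : ℝ,
      ((2 : ℝ) ^ y) ^ b * Real.exp (-(c * (2 : ℝ) ^ y)) ≤ K * (2 : ℝ) ^ (-(b * |y|)) := by
  obtain ⟨K, hK1, hK⟩ := exists_rpow_mul_exp_neg_le (b + b) c (by positivity) hc
  refine ⟨K, hK1, fun y => ?_⟩
  have h2 : (0 : ℝ) < 2 := two_pos
  rcases le_total y 0 with h | h
  · rw [abs_of_nonpos h, ← Real.rpow_mul h2.le, show -(b * -y) = y * b by ring, mul_comm K]
    gcongr
    exact (Real.exp_le_one_iff.2 (by have := Real.rpow_pos_of_pos h2 y; nlinarith)).trans hK1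
  · have := hK (2 ^ y) (by positivity)
    rw [abs_of_nonneg h, Real.rpow_neg h2.le, ← div_eq_mul_inv, le_div_iff₀ (by positivity),
      mul_comm b, Real.rpow_mul h2.le]
    rw [Real.rpow_add (by positivity)] at this
    linarith

theorem memLp_count_two_rpow_neg_abs (b : ℝ) (hb : 0 < b) (r : ℝ≥0∞) (hr : 1 ≤ r) :
    MemLp (fun q : ℤ => (2 : ℝ) ^ (-(b * |(q : ℝ)|))) r Measure.count := by
  have hS : ∀ a : ℝ, 0 < a → Summable fun q : ℤ => (2 : ℝ) ^ (-(a * |(q : ℝ)|)) := by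
    intro a ha
    have hg : Summable fun k : ℕ => ((2 : ℝ) ^ (-a)) ^ k :=
      summable_geometric_of_lt_one (by positivity)
        (Real.rpow_lt_one_of_one_lt_of_neg one_lt_two (by linarith))
    have hg' : Summable fun k : ℕ => (2 : ℝ) ^ (-(a * (k : ℝ))) := by
      refine hg.congr fun k => ?_
      rw [← Real.rpow_natCast, ← Real.rpow_mul two_pos.le]; ring_nf
    refine Summable.of_nat_of_neg ?_ ?_ <;> simpa using hg'
  rcases eq_or_ne r ∞ with rfl | hrt
  · refine memLp_top_of_bound (Measurable.of_discrete.aestronglyMeasurable) 1 (ae_of_all _ fun q => ?_)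
    rw [Real.norm_of_nonneg (by positivity)]
    exact Real.rpow_le_one_of_one_le_of_nonpos one_le_two (by have := abs_nonneg (q:ℝ); nlinarith)
  · have hr0 : r ≠ 0 := (zero_lt_one.trans_le hr).ne'
    rw [← integrable_norm_rpow_iff (Measurable.of_discrete.aestronglyMeasurable) hr0 hrt,
      integrable_count_iff]
    refine (hS (b * r.toReal) (mul_pos hb (ENNReal.toReal_pos hr0 hrt))).congr fun q => ?_
    rw [Real.norm_of_nonneg (by positivity), Real.norm_of_nonneg (by positivity),
      ← Real.rpow_mul two_pos.le]
    ring_nf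

theorem eLpNorm_fourierInv_two {n : ℕ} (g : 𝓢(EuclideanSpace ℝ (Fin n), ℂ)) :
    eLpNorm (𝓕⁻ (g : EuclideanSpace ℝ (Fin n) → ℂ)) 2 volume = eLpNorm g 2 volume := by
  set G : 𝓢(EuclideanSpace ℝ (Fin n), ℂ) := 𝓕⁻ g with hG
  have h := SchwartzMap.norm_fourier_toL2_eq G
  have hinv : 𝓕 G = g := FourierTransform.fourier_fourierInv_eq g
  rw [hinv, SchwartzMap.norm_toLp, SchwartzMap.norm_toLp, ENNReal.toReal_eq_toReal_iff'
    (g.memLp 2 volume).eLpNorm_ne_top (G.memLp 2 volume).eLpNorm_ne_top] at h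
  rw [h, hG, SchwartzMap.fourierInv_coe]

theorem enorm_fourierInv_le {n : ℕ} (g : EuclideanSpace ℝ (Fin n) → ℂ)
    (x : EuclideanSpace ℝ (Fin n)) :
    ‖𝓕⁻ g x‖ₑ ≤ eLpNorm g 1 volume := by
  rw [Real.fourierInv_eq, eLpNorm_one_eq_lintegral_enorm]
  refine (enorm_integral_le_lintegral_enorm _).trans_eq ?_
  congr 1
  ext v
  rw [← ofReal_norm, ← ofReal_norm, Circle.norm_smul]

theorem eLpNorm_two_rpow_le {α : Type*} [MeasurableSpace α] {μ : Measure α} (g : α → ℂ) (p : ℝ≥0∞)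
    (hp1 : 1 ≤ p) (hp2 : p ≤ 2) (M : ℝ≥0∞) (hM : ∀ x, ‖g x‖ₑ ≤ M) (hg : AEStronglyMeasurable g μ) :
    eLpNorm g 2 μ ^ (2 : ℝ) ≤ M ^ (2 - p.toReal) * eLpNorm g p μ ^ p.toReal := by
  have hpt : p ≠ ∞ := ne_top_of_le_ne_top ENNReal.ofNat_ne_top hp2
  have hp0 : p ≠ 0 := (zero_lt_one.trans_le hp1).ne'
  have hp2' : p.toReal ≤ 2 := ENNReal.toReal_le_of_le_ofReal two_pos.le (by simpa using hp2)
  have hp1' : 1 ≤ p.toReal := by simpa using ENNReal.toReal_mono hpt hp1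
  rw [eLpNorm_eq_lintegral_rpow_enorm_toReal hp0 hpt,
    eLpNorm_eq_lintegral_rpow_enorm_toReal two_ne_zero ENNReal.ofNat_ne_top,
    one_div, one_div, ENNReal.toReal_ofNat, ENNReal.rpow_inv_rpow two_ne_zero,
    ENNReal.rpow_inv_rpow (by positivity), ← lintegral_const_mul'' _ (by fun_prop)]
  refine lintegral_mono fun x => ?_
  calc ‖g x‖ₑ ^ (2 : ℝ) = ‖g x‖ₑ ^ (2 - p.toReal) * ‖g x‖ₑ ^ p.toReal := by
        rw [← ENNReal.rpow_add_of_nonneg _ _ (by linarith) (by linarith)]; ring_nf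
    _ ≤ _ := by gcongr; exact hM x

theorem eLpNorm_two_le_of_support_subset {n : ℕ} (g : 𝓢(EuclideanSpace ℝ (Fin n), ℂ)) (p : ℝ≥0∞)
    (hp1 : 1 ≤ p) (hp2 : p ≤ 2) (S : Set (EuclideanSpace ℝ (Fin n)))
    (hS : Function.support g ⊆ S) :
    eLpNorm g 2 volume ≤ volume S ^ (1 / p.toReal - 1 / 2) *
      eLpNorm (𝓕⁻ (g : EuclideanSpace ℝ (Fin n) → ℂ)) p volume := by
  have hpt : p ≠ ∞ := ne_top_of_le_ne_top ENNReal.ofNat_ne_top hp2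
  have hp2' : p.toReal ≤ 2 := ENNReal.toReal_le_of_le_ofReal two_pos.le (by simpa using hp2)
  have hp1' : 1 ≤ p.toReal := by simpa using ENNReal.toReal_mono hpt hp1
  have hp0 : 0 < p.toReal := by linarith
  set N := eLpNorm g 2 volume with hN
  set P := eLpNorm (𝓕⁻ (g : EuclideanSpace ℝ (Fin n) → ℂ)) p volume
  have hNt : N ≠ ∞ := (g.memLp 2 volume).eLpNorm_ne_top
  rcases eq_or_ne N 0 with h0 | h0
  · rw [h0]; exact zero_le
  have hL1 : eLpNorm g 1 volume ≤ N * volume S ^ (1 / 2 : ℝ) := by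
    have h := eLpNorm_le_eLpNorm_mul_rpow_measure_univ (μ := volume.restrict S) (f := g)
      (p := 1) (q := 2) (by norm_num) g.continuous.aestronglyMeasurable
    rw [eLpNorm_restrict_eq_of_support_subset hS, eLpNorm_restrict_eq_of_support_subset hS,
      Measure.restrict_apply_univ] at h
    convert h using 3
    norm_num
  have key := eLpNorm_two_rpow_le (μ := volume) (𝓕⁻ (g : EuclideanSpace ℝ (Fin n) → ℂ)) p hp1 hp2
    (N * volume S ^ (1 / 2 : ℝ)) (fun x => (enorm_fourierInv_le g x).trans hL1)
    (by rw [← SchwartzMap.fourierInv_coe]; exact (SchwartzMap.continuous _).aestronglyMeasurable)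
  rw [eLpNorm_fourierInv_two, ← hN, ENNReal.mul_rpow_of_nonneg _ _ (by linarith : 0 ≤ 2 - p.toReal),
    show (2 : ℝ) = (2 - p.toReal) + p.toReal by ring, ENNReal.rpow_add _ _ h0 hNt,
    show (2 - p.toReal) + p.toReal = (2 : ℝ) by ring, mul_assoc,
    ENNReal.mul_le_mul_iff_right (by simp [h0, hNt]) (by simp [h0, hNt])] at key
  have := ENNReal.rpow_le_rpow key (inv_nonneg.2 hp0.le)
  rw [ENNReal.rpow_rpow_inv hp0.ne', ENNReal.mul_rpow_of_nonneg _ _ (inv_nonneg.2 hp0.le),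
    ENNReal.rpow_rpow_inv hp0.ne', ← ENNReal.rpow_mul, ← ENNReal.rpow_mul] at this
  convert this using 3
  field_simp

theorem sq_div_le_sq_div_one_add_sq_sq {u Q x : ℝ} (hu : 0 ≤ u) (hQ : 0 < Q) (huQ : u ≤ Q)
    (huQ' : u * Q ≤ 1) (hx : 3 / 4 * Q ≤ x) (hx' : x ≤ 8 / 3 * Q) :
    u ^ 2 / 16 ≤ x ^ 2 / (1 + x ^ 2) ^ 2 := by
  have hx0 : 0 < x := by linarith
  have h : u * (1 + x ^ 2) ≤ 4 * x := by
    have h1 : u * x ≤ 8 / 3 := by nlinarith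
    nlinarith
  rw [div_le_div_iff₀ (by norm_num) (by positivity), ← mul_pow, show x ^ 2 * 16 = (4 * x) ^ 2 by ring]
  exact pow_le_pow_left₀ (by positivity) h 2

theorem exists_two_rpow_mul_exp_neg_le (β : ℝ) (hβ : 0 < β) :
    ∃ K : ℝ, 0 < K ∧ ∀ x t : ℝ, x ≤ 0 → 0 ≤ t →
      (2 : ℝ) ^ (x * β) * Real.exp (-(((2 : ℝ) ^ x) ^ 2 / 16 * t)) ≤
        K * (1 + t) ^ (-β / 2) * (2 : ℝ) ^ (-(β / 2 * |2 * x + Real.logb 2 (1 + t)|)) := by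
  obtain ⟨K, hK1, hK⟩ := exists_rpow_mul_exp_neg_le_two_rpow (β / 2) (1 / 16)
    (by positivity) (by norm_num)
  refine ⟨Real.exp 1 * K, by positivity, fun x t hx ht => ?_⟩
  have ht1 : 0 < 1 + t := by linarith
  have h := hK (2 * x + Real.logb 2 (1 + t))
  have hz : (2 : ℝ) ^ (2 * x + Real.logb 2 (1 + t)) = ((2 : ℝ) ^ x) ^ 2 * (1 + t) := by
    rw [Real.rpow_add two_pos, Real.rpow_logb two_pos (by norm_num) ht1, mul_comm 2 x,
      Real.rpow_mul two_pos.le, Real.rpow_two]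
  rw [hz, Real.mul_rpow (by positivity) ht1.le] at h
  have hsq : (((2 : ℝ) ^ x) ^ 2) ^ (β / 2) = (2 : ℝ) ^ (x * β) := by
    rw [← Real.rpow_two, ← Real.rpow_mul two_pos.le, ← Real.rpow_mul two_pos.le]; ring_nf
  rw [hsq] at h
  have hle : (2 : ℝ) ^ x ≤ 1 := Real.rpow_le_one_of_one_le_of_nonpos one_le_two hx
  have hpos : (0 : ℝ) < (2 : ℝ) ^ x := by positivity
  have hexp : Real.exp (-(((2 : ℝ) ^ x) ^ 2 / 16 * t)) ≤
      Real.exp 1 * Real.exp (-(1 / 16 * (((2 : ℝ) ^ x) ^ 2 * (1 + t)))) := by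
    rw [← Real.exp_add]
    exact Real.exp_le_exp.2 (by nlinarith)
  have hinv : (1 + t) ^ (-β / 2) * (1 + t) ^ (β / 2) = 1 := by
    rw [← Real.rpow_add ht1]; simp [neg_div]
  calc _ ≤ (2 : ℝ) ^ (x * β) *
        (Real.exp 1 * Real.exp (-(1 / 16 * (((2 : ℝ) ^ x) ^ 2 * (1 + t))))) := by gcongr
    _ = Real.exp 1 * (1 + t) ^ (-β / 2) * ((2 : ℝ) ^ (x * β) * (1 + t) ^ (β / 2) *
        Real.exp (-(1 / 16 * (((2 : ℝ) ^ x) ^ 2 * (1 + t))))) := by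
      linear_combination (-(2 : ℝ) ^ (x * β) * (Real.exp 1 *
        Real.exp (-(1 / 16 * (((2 : ℝ) ^ x) ^ 2 * (1 + t)))))) * hinv
    _ ≤ Real.exp 1 * (1 + t) ^ (-β / 2) *
        (K * (2 : ℝ) ^ (-(β / 2 * |2 * x + Real.logb 2 (1 + t)|))) := by gcongr
    _ = _ := by ring

theorem exists_two_rpow_mul_exp_neg_le_rpow (β : ℝ) (hβ : 0 ≤ β) :
    ∃ K : ℝ, 0 < K ∧ ∀ x t : ℝ, x ≤ 0 → 0 ≤ t →
      (2 : ℝ) ^ (x * β) * Real.exp (-(((2 : ℝ) ^ x) ^ 2 / 16 * t)) ≤ K * (1 + t) ^ (-β / 2) := by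
  rcases hβ.eq_or_lt with rfl | hβ
  · refine ⟨1, one_pos, fun x t _ ht => ?_⟩
    simp only [mul_zero, Real.rpow_zero, neg_zero, zero_div, one_mul]
    exact Real.exp_le_one_iff.2 (neg_nonpos.2 (by positivity))
  · obtain ⟨K, hK0, hK⟩ := exists_two_rpow_mul_exp_neg_le β hβ
    refine ⟨K, hK0, fun x t hx ht => (hK x t hx ht).trans (mul_le_of_le_one_right (by positivity) ?_)⟩
    exact Real.rpow_le_one_of_one_le_of_nonpos one_le_two (neg_nonpos.2 (by positivity))

theorem exists_eLpNorm_count_two_rpow_le (b : ℝ) (hb : 0 < b) (r : ℝ≥0∞) (hr : 1 ≤ r) :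
    ∃ D : ℝ, 0 < D ∧ ∀ τ : ℝ,
      eLpNorm (fun q : ℤ => (2 : ℝ) ^ (-(b * |2 * (q : ℝ) + τ|))) r Measure.count ≤
        ENNReal.ofReal D := by
  have hm := memLp_count_two_rpow_neg_abs (2 * b) (by positivity) r hr
  set L := eLpNorm (fun q : ℤ => (2 : ℝ) ^ (-(2 * b * |(q : ℝ)|))) r Measure.count with hL
  refine ⟨(2 : ℝ) ^ (2 * b) * (L.toReal + 1), by positivity, fun τ => ?_⟩
  set N := ⌊τ / 2⌋
  have hN1 : (N : ℝ) ≤ τ / 2 := Int.floor_le _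
  have hN2 : τ / 2 < N + 1 := Int.lt_floor_add_one _
  have h := eLpNorm_le_mul_eLpNorm_of_ae_le_mul (μ := Measure.count) (c := (2 : ℝ) ^ (2 * b))
    (f := fun q : ℤ => (2 : ℝ) ^ (-(b * |2 * (q : ℝ) + τ|)))
    (g := (fun q : ℤ => (2 : ℝ) ^ (-(2 * b * |(q : ℝ)|))) ∘ fun q : ℤ => q + N)
    (ae_of_all _ fun q => by
      rw [Function.comp_apply, Real.norm_of_nonneg (by positivity), Real.norm_of_nonneg (by positivity),
        ← Real.rpow_add two_pos]
      refine Real.rpow_le_rpow_of_exponent_le one_le_two ?_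
      have : 2 * |((q + N : ℤ) : ℝ)| ≤ |2 * (q : ℝ) + τ| + 2 := by
        push_cast
        rcases abs_cases ((q : ℝ) + N) with h | h <;>
          rcases abs_cases (2 * (q : ℝ) + τ) with h' | h' <;>
          linarith
      nlinarith) r
  rw [eLpNorm_comp_measurePreserving hm.1 (measurePreserving_add_right _ N), ← hL] at h
  refine h.trans ?_
  rw [ENNReal.ofReal_mul (by positivity)]
  gcongr
  exact (ENNReal.ofReal_toReal hm.eLpNorm_ne_top).symm.trans_le
    (ENNReal.ofReal_le_ofReal (by linarith))

theorem IsLP.norm_mem {n : ℕ} {φ : EuclideanSpace ℝ (Fin n) → ℝ} (hφ : IsLP φ) {q : ℤ}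
    {ξ : EuclideanSpace ℝ (Fin n)} (h : φ ((2 : ℝ) ^ (-q) • ξ) ≠ 0) :
    3 / 4 * (2 : ℝ) ^ (q : ℝ) ≤ ‖ξ‖ ∧ ‖ξ‖ ≤ 8 / 3 * (2 : ℝ) ^ (q : ℝ) := by
  have h' := hφ.supp _ h
  rw [norm_smul, Real.norm_of_nonneg (by positivity), zpow_neg, inv_mul_eq_div,
    le_div_iff₀ (by positivity), div_le_iff₀ (by positivity)] at h'
  rwa [Real.rpow_intCast]

theorem IsLP.exists_schwartzMap_eq {n : ℕ} {φ : EuclideanSpace ℝ (Fin n) → ℝ} (hφ : IsLP φ)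
    (f : 𝓢(EuclideanSpace ℝ (Fin n), ℂ)) (q : ℤ) :
    ∃ g : 𝓢(EuclideanSpace ℝ (Fin n), ℂ),
      (g : EuclideanSpace ℝ (Fin n) → ℂ) =
        fun ξ => (φ ((2 : ℝ) ^ (-q) • ξ) : ℂ) * 𝓕 (f : EuclideanSpace ℝ (Fin n) → ℂ) ξ := by
  have hc : HasCompactSupport fun ξ =>
      (φ ((2 : ℝ) ^ (-q) • ξ) : ℂ) * 𝓕 (f : EuclideanSpace ℝ (Fin n) → ℂ) ξ := by
    refine HasCompactSupport.intro
      (isCompact_closedBall (0 : EuclideanSpace ℝ (Fin n)) (8 / 3 * (2 : ℝ) ^ (q : ℝ))) ?_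
    intro ξ hξ
    have : φ ((2 : ℝ) ^ (-q) • ξ) = 0 := by
      by_contra h
      exact hξ (mem_closedBall_zero_iff.2 (hφ.norm_mem h).2)
    simp only [this, Complex.ofReal_zero, zero_mul]
  have hs : ContDiff ℝ (⊤ : ℕ∞) fun ξ =>
      (φ ((2 : ℝ) ^ (-q) • ξ) : ℂ) * 𝓕 (f : EuclideanSpace ℝ (Fin n) → ℂ) ξ := by
    refine ContDiff.mul ?_ ?_
    · exact Complex.ofRealCLM.contDiff.comp (hφ.smooth.comp (contDiff_const_smul _))
    · rw [← SchwartzMap.fourier_coe]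
      exact SchwartzMap.smooth _ _
  exact ⟨hc.toSchwartzMap hs, rfl⟩

theorem IsLP.eLpNorm_mul_exp_le {n : ℕ} {φ : EuclideanSpace ℝ (Fin n) → ℝ} (hφ : IsLP φ)
    (f : 𝓢(EuclideanSpace ℝ (Fin n), ℂ)) (q : ℤ) {u t : ℝ} (hu : 0 ≤ u)
    (huq : u ≤ (2 : ℝ) ^ (q : ℝ)) (huq' : u * (2 : ℝ) ^ (q : ℝ) ≤ 1) (ht : 0 ≤ t) :
    (eLpNorm (fun ξ => (φ ((2 : ℝ) ^ (-q) • ξ) : ℂ) * 𝓕 (f : EuclideanSpace ℝ (Fin n) → ℂ) ξ *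
      (Real.exp (-(‖ξ‖ ^ 2 / (1 + ‖ξ‖ ^ 2) ^ 2) * t) : ℝ)) 2 volume).toReal ≤
    Real.exp (-(u ^ 2 / 16 * t)) * (eLpNorm (blk φ q f) 2 volume).toReal := by
  obtain ⟨g, hg⟩ := hφ.exists_schwartzMap_eq f q
  have hb : eLpNorm (blk φ q f) 2 volume = eLpNorm g 2 volume := by
    rw [blk, ← hg, eLpNorm_fourierInv_two]
  rw [hb]
  have h := eLpNorm_le_mul_eLpNorm_of_ae_le_mul (μ := volume) (c := Real.exp (-(u ^ 2 / 16 * t)))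
    (f := fun ξ => (φ ((2 : ℝ) ^ (-q) • ξ) : ℂ) * 𝓕 (f : EuclideanSpace ℝ (Fin n) → ℂ) ξ *
      (Real.exp (-(‖ξ‖ ^ 2 / (1 + ‖ξ‖ ^ 2) ^ 2) * t) : ℝ)) (g := g)
    (ae_of_all _ fun ξ => by
      simp only [hg]
      rw [norm_mul, mul_comm, Complex.norm_of_nonneg (Real.exp_pos _).le]
      rcases eq_or_ne (φ ((2 : ℝ) ^ (-q) • ξ)) 0 with h0 | h0
      · simp only [h0, Complex.ofReal_zero, zero_mul, norm_zero, mul_zero, le_refl]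
      · gcongr
        have := hφ.norm_mem h0
        have := sq_div_le_sq_div_one_add_sq_sq hu (by positivity) huq huq' this.1 this.2
        nlinarith) 2
  have := ENNReal.toReal_mono
    (ENNReal.mul_ne_top ENNReal.ofReal_ne_top (g.memLp 2 volume).eLpNorm_ne_top) h
  rwa [ENNReal.toReal_mul, ENNReal.toReal_ofReal (Real.exp_pos _).le] at this

theorem IsLP.eLpNorm_blk_two_le {n : ℕ} {φ : EuclideanSpace ℝ (Fin n) → ℝ} (hφ : IsLP φ)
    (f : 𝓢(EuclideanSpace ℝ (Fin n), ℂ)) (q : ℤ) {p : ℝ≥0∞} (hp1 : 1 ≤ p) (hp2 : p ≤ 2) :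
    (eLpNorm (blk φ q f) 2 volume).toReal ≤
      (volume (Metric.closedBall (0 : EuclideanSpace ℝ (Fin n)) (8 / 3))).toReal
          ^ (1 / p.toReal - 1 / 2) *
        (2 : ℝ) ^ ((q : ℝ) * (n * (1 / p.toReal - 1 / 2))) *
        (eLpNorm (blk φ q f) p volume).toReal := by
  obtain ⟨g, hg⟩ := hφ.exists_schwartzMap_eq f q
  have h := eLpNorm_two_le_of_support_subset g p hp1 hp2
    (Metric.closedBall 0 ((2 : ℝ) ^ (q : ℝ) * (8 / 3))) fun ξ hξ => by
      rw [mem_closedBall_zero_iff, mul_comm]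
      refine (hφ.norm_mem (q := q) fun h0 => hξ ?_).2
      simp only [hg, h0, Complex.ofReal_zero, zero_mul]
  have hP : eLpNorm (𝓕⁻ (g : EuclideanSpace ℝ (Fin n) → ℂ)) p volume ≠ ∞ := by
    rw [← SchwartzMap.fourierInv_coe]
    exact (SchwartzMap.memLp _ p volume).eLpNorm_ne_top
  have hδ : 0 ≤ 1 / p.toReal - 1 / 2 := by
    have hpt : p ≠ ∞ := ne_top_of_le_ne_top ENNReal.ofNat_ne_top hp2
    have hp0 : 0 < p.toReal := ENNReal.toReal_pos (zero_lt_one.trans_le hp1).ne' hpt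
    have hp2' : p.toReal ≤ 2 := ENNReal.toReal_le_of_le_ofReal two_pos.le (by simpa using hp2)
    exact sub_nonneg.2 (one_div_le_one_div_of_le hp0 hp2')
  have hblk : blk φ q f = 𝓕⁻ (g : EuclideanSpace ℝ (Fin n) → ℂ) := by rw [hg, blk]
  rw [hblk, eLpNorm_fourierInv_two]
  have h' := ENNReal.toReal_mono (ENNReal.mul_ne_top
    (ENNReal.rpow_ne_top_of_nonneg hδ measure_closedBall_lt_top.ne) hP) h
  rw [ENNReal.toReal_mul, Measure.addHaar_closedBall_mul _ _ (by positivity) (by norm_num),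
    finrank_euclideanSpace_fin, ← ENNReal.toReal_rpow, ENNReal.toReal_mul,
    ENNReal.toReal_ofReal (by positivity), Real.mul_rpow (by positivity) ENNReal.toReal_nonneg,
    ← Real.rpow_natCast, ← Real.rpow_mul two_pos.le, ← Real.rpow_mul two_pos.le] at h'
  refine h'.trans_eq ?_
  rw [mul_assoc (q : ℝ), mul_comm ((2 : ℝ) ^ _)]

/-- Proposition 3.1, frequency-localization time-decay
inequality. With `η(ξ) = |ξ|²/(1+|ξ|²)²`, `σ+s > 0`, `r ∈ [1,∞]`,
`p ∈ [1,2]`, `ℓ > n(1/p − 1/2)` (`ℓ ≥ 0` if `p = 2`):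
`‖2^{qσ} ‖𝔉(Δ̇_q f) e^{-ηt}‖_{L²}‖_{ℓ^r_q}
  ≲ (1+t)^{-(σ+s)/2} ‖f‖_{Ḃ^{-s}_{2,∞}}
    + (1+t)^{-ℓ/2+(n/2)(1/p−1/2)} ‖f‖_{Ḃ^{σ+ℓ}_{p,r}}`. -/
theorem stmt3 (n : ℕ) (hn : 0 < n) (φ : EuclideanSpace ℝ (Fin n) → ℝ)
    (hφ : IsLP φ) (σ s ℓ : ℝ) (hσs : 0 < σ + s) (r p : ℝ≥0∞)
    (hr : 1 ≤ r) (hp1 : 1 ≤ p) (hp2 : p ≤ 2)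
    (hℓ : if p = 2 then 0 ≤ ℓ else (n:ℝ) * (1 / p.toReal - 1/2) < ℓ) :
    ∃ C > (0:ℝ), ∀ f : 𝓢(EuclideanSpace ℝ (Fin n), ℂ), ∀ t : ℝ, 0 ≤ t →
      lpSeq r (fun q => (2:ℝ) ^ ((q:ℝ) * σ) *
          (eLpNorm
            (fun ξ => (φ ((2:ℝ)^(-q) • ξ) : ℂ) * 𝓕 (⇑f) ξ *
              (Real.exp (-(‖ξ‖^2 / (1 + ‖ξ‖^2)^2) * t) : ℝ))
            2 volume).toReal)
      ≤ ENNReal.ofReal (C * (1 + t) ^ (-(σ + s)/2)) * besov φ (-s) 2 ∞ (⇑f)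
        + ENNReal.ofReal
            (C * (1 + t) ^ (-ℓ/2 + (n:ℝ)/2 * (1 / p.toReal - 1/2))) *
          besov φ (σ + ℓ) p r (⇑f) := by
  set δ : ℝ := 1 / p.toReal - 1 / 2 with hδ
  have hα : 0 ≤ ℓ - n * δ := by
    split_ifs at hℓ with h
    · rw [hδ, h]; simpa using hℓ
    · exact (sub_pos.2 hℓ).le
  obtain ⟨K₁, hK₁, hlow⟩ := exists_two_rpow_mul_exp_neg_le (σ + s) hσs
  obtain ⟨K₂, hK₂, hhigh⟩ := exists_two_rpow_mul_exp_neg_le_rpow (ℓ - n * δ) hα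
  obtain ⟨D, hD, hA⟩ := exists_eLpNorm_count_two_rpow_le ((σ + s) / 2) (by positivity) r hr
  set V : ℝ := (volume (Metric.closedBall (0 : EuclideanSpace ℝ (Fin n)) (8 / 3))).toReal ^ δ
  have hV0 : 0 ≤ V := by positivity
  refine ⟨K₁ * D + K₂ * V, by positivity, fun f t ht => ?_⟩
  have ht1 : 0 < 1 + t := by linarith
  set X : ℤ → ℝ := fun q => (eLpNorm (fun ξ => (φ ((2 : ℝ) ^ (-q) • ξ) : ℂ) * 𝓕 (⇑f) ξ *
    (Real.exp (-(‖ξ‖ ^ 2 / (1 + ‖ξ‖ ^ 2) ^ 2) * t) : ℝ)) 2 volume).toReal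
  set A : ℤ → ℝ := fun q =>
    (2 : ℝ) ^ (-((σ + s) / 2 * |2 * (q : ℝ) + Real.logb 2 (1 + t)|))
  set b : ℤ → ℝ := fun q =>
    (2 : ℝ) ^ ((q : ℝ) * -s) * (eLpNorm (blk φ q f) 2 volume).toReal with hb
  set d : ℤ → ℝ := fun q =>
    (2 : ℝ) ^ ((q : ℝ) * (σ + ℓ)) * (eLpNorm (blk φ q f) p volume).toReal with hd
  set c₁ : ℝ := K₁ * (1 + t) ^ (-(σ + s) / 2) with hc₁
  set c₂ : ℝ := K₂ * V * (1 + t) ^ (-(ℓ - n * δ) / 2) with hc₂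
  have hA0 : ∀ q, 0 ≤ A q := fun q => by positivity
  have hb0 : ∀ q, 0 ≤ b q := fun q => by positivity
  have hd0 : ∀ q, 0 ≤ d q := fun q => by positivity
  have hc₁0 : 0 ≤ c₁ := by positivity
  have hc₂0 : 0 ≤ c₂ := by positivity
  have hpt_le : ∀ q : ℤ, (2 : ℝ) ^ ((q : ℝ) * σ) * X q ≤ c₁ * (A q * b q) + c₂ * d q := by
    intro q
    rcases le_total (q : ℝ) 0 with hq | hq
    · have h1 := hφ.eLpNorm_mul_exp_le f q (u := (2 : ℝ) ^ (q : ℝ)) (by positivity) le_rfl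
        (by rw [← Real.rpow_add two_pos]
            exact Real.rpow_le_one_of_one_le_of_nonpos one_le_two (by linarith)) ht
      refine le_trans ?_ (le_add_of_nonneg_right (mul_nonneg hc₂0 (hd0 q)))
      calc _ ≤ (2 : ℝ) ^ ((q : ℝ) * σ) * (Real.exp (-(((2 : ℝ) ^ (q : ℝ)) ^ 2 / 16 * t)) *
            (eLpNorm (blk φ q f) 2 volume).toReal) := by gcongr
        _ = (2 : ℝ) ^ ((q : ℝ) * (σ + s)) * Real.exp (-(((2 : ℝ) ^ (q : ℝ)) ^ 2 / 16 * t)) *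
            b q := by
          rw [show (q : ℝ) * σ = (q : ℝ) * (σ + s) + (q : ℝ) * -s by ring, Real.rpow_add two_pos]
          simp only [hb]; ring
        _ ≤ c₁ * A q * b q := mul_le_mul_of_nonneg_right (hlow q t hq ht) (hb0 q)
        _ = _ := mul_assoc _ _ _
    · have h1 := hφ.eLpNorm_mul_exp_le f q (u := (2 : ℝ) ^ (-(q : ℝ))) (by positivity)
        (Real.rpow_le_rpow_of_exponent_le one_le_two (by linarith))
        (by rw [← Real.rpow_add two_pos]; simp) ht
      have h2 := hφ.eLpNorm_blk_two_le f q hp1 hp2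
      refine le_trans ?_ (le_add_of_nonneg_left (mul_nonneg hc₁0 (mul_nonneg (hA0 q) (hb0 q))))
      calc _ ≤ (2 : ℝ) ^ ((q : ℝ) * σ) * (Real.exp (-(((2 : ℝ) ^ (-(q : ℝ))) ^ 2 / 16 * t)) *
            (V * (2 : ℝ) ^ ((q : ℝ) * (n * δ)) * (eLpNorm (blk φ q f) p volume).toReal)) := by
            gcongr; exact h1.trans (by gcongr)
        _ = (2 : ℝ) ^ (-(q : ℝ) * (ℓ - n * δ)) *
            Real.exp (-(((2 : ℝ) ^ (-(q : ℝ))) ^ 2 / 16 * t)) * (V * d q) := by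
          have : (2 : ℝ) ^ ((q : ℝ) * σ) * (2 : ℝ) ^ ((q : ℝ) * (n * δ)) =
              (2 : ℝ) ^ (-(q : ℝ) * (ℓ - n * δ)) * (2 : ℝ) ^ ((q : ℝ) * (σ + ℓ)) := by
            rw [← Real.rpow_add two_pos, ← Real.rpow_add two_pos]; ring_nf
          simp only [hd]
          linear_combination (Real.exp (-(((2 : ℝ) ^ (-(q : ℝ))) ^ 2 / 16 * t)) *
            V * (eLpNorm (blk φ q f) p volume).toReal) * this
        _ ≤ K₂ * (1 + t) ^ (-(ℓ - n * δ) / 2) * (V * d q) :=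
          mul_le_mul_of_nonneg_right (hhigh _ t (by linarith) ht) (mul_nonneg hV0 (hd0 q))
        _ = _ := by rw [hc₂]; ring
  have hmeas : ∀ g : ℤ → ℝ, AEStronglyMeasurable g Measure.count :=
    fun g => Measurable.of_discrete.aestronglyMeasurable
  have hAb : eLpNorm (fun q => c₁ * (A q * b q)) r Measure.count ≤
      ENNReal.ofReal ((K₁ * D + K₂ * V) * (1 + t) ^ (-(σ + s) / 2)) *
        eLpNorm b ∞ Measure.count := by
    have h1 := eLpNorm_le_mul_eLpNorm_of_ae_le_mul (μ := Measure.count) (c := c₁)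
      (f := fun q => c₁ * (A q * b q)) (g := fun q => A q * b q)
      (ae_of_all _ fun q => by rw [norm_mul, Real.norm_of_nonneg hc₁0]) r
    have h2 := eLpNorm_le_eLpNorm_mul_eLpNorm_top (μ := Measure.count) r (hmeas A) b
      (fun x y => x * y) 1 (ae_of_all _ fun q => by simp)
    rw [ENNReal.coe_one, one_mul] at h2
    calc _ ≤ ENNReal.ofReal c₁ * (ENNReal.ofReal D * eLpNorm b ∞ Measure.count) := by
          refine h1.trans ?_
          gcongr
          refine h2.trans ?_
          gcongr
          exact hA _
      _ = ENNReal.ofReal (c₁ * D) * eLpNorm b ∞ Measure.count := by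
          rw [← mul_assoc, ENNReal.ofReal_mul hc₁0]
      _ ≤ _ := by
          gcongr ENNReal.ofReal ?_ * _
          rw [hc₁, mul_right_comm]
          gcongr
          exact le_add_of_nonneg_right (by positivity)
  have hdd : eLpNorm (fun q => c₂ * d q) r Measure.count ≤
      ENNReal.ofReal ((K₁ * D + K₂ * V) * (1 + t) ^ (-ℓ / 2 + (n : ℝ) / 2 * δ)) *
        eLpNorm d r Measure.count := by
    refine (eLpNorm_le_mul_eLpNorm_of_ae_le_mul (μ := Measure.count) (c := c₂) (g := d)
      (ae_of_all _ fun q => by rw [norm_mul, Real.norm_of_nonneg hc₂0]) r).trans ?_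
    gcongr ENNReal.ofReal ?_ * _
    rw [show -(ℓ - n * δ) / 2 = -ℓ / 2 + (n : ℝ) / 2 * δ by ring]
    gcongr
    exact le_add_of_nonneg_left (by positivity)
  calc eLpNorm (fun q : ℤ => (2 : ℝ) ^ ((q : ℝ) * σ) * X q) r Measure.count
      ≤ eLpNorm ((fun q => c₁ * (A q * b q)) + fun q => c₂ * d q) r Measure.count := by
        refine eLpNorm_mono_real fun q => ?_
        rw [Real.norm_of_nonneg (by positivity)]
        exact hpt_le q
    _ ≤ _ := eLpNorm_add_le (hmeas _) (hmeas _) hr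
    _ ≤ _ := add_le_add hAb hdd
end
end

section
/- Let s₁, s₂ ≤ n/p with s₁ + s₂ > n·max{0, 2/p − 1}. Then for f ∈ Ḃ^{s₁}_{p,1}(ℝⁿ) and g ∈ Ḃ^{s₂}_{p,1}(ℝⁿ), the product satisfies ‖fg‖_{Ḃ^{s₁+s₂−n/p}_{p,1}} ≲ ‖f‖_{Ḃ^{s₁}_{p,1}} ‖g‖_{Ḃ^{s₂}_{p,1}}. -/
open MeasureTheory Real ENNReal SchwartzMap
open scoped FourierTransform
noncomputable section

section

theorem rpow_lintegral_mul_le {α : Type*} [MeasurableSpace α] {μ : Measure α}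
    {k h : α → ℝ≥0∞} (hk : Measurable k) (hh : Measurable h) {m : ℝ} (hm : 1 ≤ m) :
    (∫⁻ y, k y * h y ∂μ) ^ m ≤ (∫⁻ y, k y ∂μ) ^ (m - 1) * ∫⁻ y, k y * h y ^ m ∂μ := by
  have hm0 : 0 < m := by linarith
  have H := eLpNorm'_le_eLpNorm'_mul_rpow_measure_univ (μ := μ.withDensity k) (f := h)
    one_pos hm hh.aestronglyMeasurable
  simp only [eLpNorm', enorm_eq_self, ENNReal.rpow_one, one_div, inv_one,
    withDensity_apply _ .univ, Measure.restrict_univ] at H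
  rw [lintegral_withDensity_eq_lintegral_mul _ hk hh,
    lintegral_withDensity_eq_lintegral_mul _ hk (hh.pow_const m)] at H
  calc (∫⁻ y, k y * h y ∂μ) ^ m ≤ _ := ENNReal.rpow_le_rpow H hm0.le
    _ = _ := by
      rw [ENNReal.mul_rpow_of_nonneg _ _ hm0.le, ← ENNReal.rpow_mul, ← ENNReal.rpow_mul,
        inv_mul_cancel₀ hm0.ne', ENNReal.rpow_one, mul_comm, sub_mul, inv_mul_cancel₀ hm0.ne',
        one_mul]
      rfl

theorem eLpNorm_le_of_eLpNorm_top_le {α : Type*} [MeasurableSpace α] {μ : Measure α} {f : α → ℂ}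
    {m l A B : ℝ≥0∞} (hm : 1 ≤ m) (hm' : m ≠ ∞) (hl : m ≤ l)
    (hA : A ≠ ∞) (hB0 : B ≠ 0) (hB : B ≠ ∞)
    (h1 : eLpNorm f m μ ≤ A) (h2 : eLpNorm f ∞ μ ≤ A * B ^ m⁻¹.toReal) :
    eLpNorm f l μ ≤ A * B ^ (m⁻¹.toReal - l⁻¹.toReal) := by
  rcases eq_or_ne l ∞ with rfl | hl'
  · simpa using h2
  have hm0 : 0 < m.toReal := ENNReal.toReal_pos (by positivity) hm'
  have hml : m.toReal ≤ l.toReal := (ENNReal.toReal_le_toReal hm' hl').2 hl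
  have hl0 : 0 < l.toReal := hm0.trans_le hml
  rw [eLpNorm_eq_lintegral_rpow_enorm_toReal (by positivity) hm', one_div,
    ENNReal.rpow_inv_le_iff hm0] at h1
  rw [eLpNorm_eq_lintegral_rpow_enorm_toReal (by intro h; simp [h] at hl0) hl', one_div,
    ENNReal.rpow_inv_le_iff hl0]
  have h3 : ∀ᵐ x ∂μ, ‖f x‖ₑ ≤ A * B ^ m⁻¹.toReal := by
    rw [eLpNorm_exponent_top] at h2
    filter_upwards [ae_le_eLpNormEssSup (f := f) (μ := μ)] with x hx using hx.trans h2
  have hc : 0 ≤ l.toReal - m.toReal := by linarith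
  calc ∫⁻ x, ‖f x‖ₑ ^ l.toReal ∂μ
      ≤ ∫⁻ x, (A * B ^ m⁻¹.toReal) ^ (l.toReal - m.toReal) * ‖f x‖ₑ ^ m.toReal ∂μ := by
        refine lintegral_mono_ae ?_
        filter_upwards [h3] with x hx
        calc ‖f x‖ₑ ^ l.toReal = ‖f x‖ₑ ^ (l.toReal - m.toReal) * ‖f x‖ₑ ^ m.toReal := by
              rw [← ENNReal.rpow_add_of_nonneg _ _ hc hm0.le, sub_add_cancel]
          _ ≤ _ := by gcongr
    _ ≤ (A * B ^ m⁻¹.toReal) ^ (l.toReal - m.toReal) * A ^ m.toReal := by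
        rw [lintegral_const_mul']
        · gcongr
        · exact ENNReal.rpow_ne_top_of_nonneg hc
            (ENNReal.mul_ne_top hA (ENNReal.rpow_ne_top_of_ne_zero hB0 hB))
    _ = _ := by
        rw [ENNReal.mul_rpow_of_nonneg _ _ hc, ENNReal.mul_rpow_of_nonneg _ _ hl0.le, mul_right_comm,
          ← ENNReal.rpow_add_of_nonneg _ _ hc hm0.le, sub_add_cancel, ← ENNReal.rpow_mul,
          ← ENNReal.rpow_mul, ENNReal.toReal_inv, ENNReal.toReal_inv]
        congr 2
        field_simp

/-- Minkowski's inequality for pointwise convergent countable sums. -/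
theorem eLpNorm_le_tsum_of_hasSum {α ι : Type*} [MeasurableSpace α] {μ : Measure α} [Countable ι]
    {p : ℝ≥0∞} (hp : 1 ≤ p) {F : ι → α → ℂ} {f : α → ℂ} (hF : ∀ i, AEStronglyMeasurable (F i) μ)
    (h : ∀ x, HasSum (fun i => F i x) (f x)) :
    eLpNorm f p μ ≤ ∑' i, eLpNorm (F i) p μ := by
  obtain ⟨s, hs⟩ := Filter.exists_seq_tendsto (Filter.atTop : Filter (Finset ι))
  refine (Lp.eLpNorm_lim_le_liminf_eLpNorm (f := fun n x => ∑ i ∈ s n, F i x) (fun n => ?_) f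
    (.of_forall fun x => (h x).comp hs)).trans ?_
  · exact Finset.aestronglyMeasurable_fun_sum _ fun i _ => hF i
  · refine Filter.liminf_le_of_frequently_le' (.of_forall fun n => ?_)
    calc eLpNorm (fun x => ∑ i ∈ s n, F i x) p μ = eLpNorm (∑ i ∈ s n, F i) p μ := by
          congr 1; ext x; simp
      _ ≤ ∑ i ∈ s n, eLpNorm (F i) p μ := eLpNorm_sum_le (fun i _ => hF i) hp
      _ ≤ _ := ENNReal.sum_le_tsum _

variable {n : ℕ}

/-- Young-type bounds for convolution against an `L¹ ∩ L^∞` kernel. -/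
theorem eLpNorm_convolution_le {K h f : EuclideanSpace ℝ (Fin n) → ℂ} (hK : Continuous K)
    (hh : Continuous h) (hf : ∀ x, ‖f x‖ₑ ≤ ∫⁻ y, ‖K (x - y)‖ₑ * ‖h y‖ₑ)
    {C B m l : ℝ≥0∞} (hC' : C ≠ ∞) (hB0 : B ≠ 0) (hB : B ≠ ∞)
    (hK1 : ∫⁻ y, ‖K y‖ₑ ≤ C) (hK2 : ∀ x, ‖K x‖ₑ ≤ C * B)
    (hm : 1 ≤ m) (hm' : m ≠ ∞) (hl : m ≤ l) (hhm : eLpNorm h m volume ≠ ∞) :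
    eLpNorm f l volume ≤ C * B ^ (m⁻¹.toReal - l⁻¹.toReal) * eLpNorm h m volume := by
  have hm0 : 0 < m.toReal := ENNReal.toReal_pos (by positivity) hm'
  have hm1 : 1 ≤ m.toReal := by simpa using (ENNReal.toReal_le_toReal one_ne_top hm').2 hm
  have hm2 : 0 ≤ m.toReal - 1 := by linarith
  have key : ∀ x, ‖f x‖ₑ ^ m.toReal ≤
      C ^ (m.toReal - 1) * ∫⁻ y, ‖K (x - y)‖ₑ * ‖h y‖ₑ ^ m.toReal := fun x => by
    calc ‖f x‖ₑ ^ m.toReal ≤ _ := ENNReal.rpow_le_rpow (hf x) hm0.le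
      _ ≤ _ := rpow_lintegral_mul_le (Continuous.measurable (by fun_prop)) (by fun_prop) hm1
      _ ≤ _ := by
        rw [lintegral_sub_left_eq_self (fun y => ‖K y‖ₑ) x]
        gcongr
  have hCm : C ^ (m.toReal - 1) * C = C ^ m.toReal := by
    conv_lhs => rw [← ENNReal.rpow_one C, ← ENNReal.rpow_mul, one_mul]
    rw [← ENNReal.rpow_add_of_nonneg _ _ hm2 zero_le_one, sub_add_cancel]
  have hhI : ∫⁻ y, ‖h y‖ₑ ^ m.toReal = eLpNorm h m volume ^ m.toReal := by
    rw [eLpNorm_eq_lintegral_rpow_enorm_toReal (by positivity) hm', one_div,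
      ENNReal.rpow_inv_rpow hm0.ne']
  rw [mul_right_comm]
  refine eLpNorm_le_of_eLpNorm_top_le hm hm' hl (ENNReal.mul_ne_top hC' hhm) hB0 hB ?_ ?_
  · rw [eLpNorm_eq_lintegral_rpow_enorm_toReal (by positivity) hm', one_div,
      ENNReal.rpow_inv_le_iff hm0]
    calc ∫⁻ x, ‖f x‖ₑ ^ m.toReal
        ≤ ∫⁻ x, C ^ (m.toReal - 1) * ∫⁻ y, ‖K (x - y)‖ₑ * ‖h y‖ₑ ^ m.toReal :=
          lintegral_mono key
      _ = C ^ (m.toReal - 1) * ∫⁻ y, ∫⁻ x, ‖K (x - y)‖ₑ * ‖h y‖ₑ ^ m.toReal := by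
          rw [lintegral_const_mul' _ _ (ENNReal.rpow_ne_top_of_nonneg hm2 hC'),
            lintegral_lintegral_swap]
          fun_prop
      _ = C ^ (m.toReal - 1) * ∫⁻ y, (∫⁻ x, ‖K x‖ₑ) * ‖h y‖ₑ ^ m.toReal := by
          congr 2
          ext y
          rw [lintegral_mul_const _ (Continuous.measurable (by fun_prop)),
            lintegral_sub_right_eq_self (fun x => ‖K x‖ₑ) y]
      _ ≤ C ^ (m.toReal - 1) * (C * ∫⁻ y, ‖h y‖ₑ ^ m.toReal) := by
          rw [lintegral_const_mul _ (by fun_prop)]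
          gcongr
      _ = _ := by
          rw [← mul_assoc, hCm, hhI, ENNReal.mul_rpow_of_nonneg _ _ hm0.le]
  · rw [eLpNorm_exponent_top]
    refine eLpNormEssSup_le_of_ae_enorm_bound (.of_forall fun x => ?_)
    rw [← ENNReal.rpow_le_rpow_iff hm0]
    calc ‖f x‖ₑ ^ m.toReal ≤ _ := key x
      _ ≤ C ^ (m.toReal - 1) * ∫⁻ y, C * B * ‖h y‖ₑ ^ m.toReal := by
        gcongr with y
        exact hK2 _
      _ = _ := by
        rw [lintegral_const_mul _ (by fun_prop), ENNReal.mul_rpow_of_nonneg _ _ hm0.le,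
          ENNReal.mul_rpow_of_nonneg _ _ hm0.le, ← ENNReal.rpow_mul, ENNReal.toReal_inv,
          inv_mul_cancel₀ hm0.ne', ENNReal.rpow_one, hhI, ← hCm]
        ring

/-- The dyadic dilate `φ(2^{-q}·)` as a Schwartz function. -/
def lpSymbol {φ : EuclideanSpace ℝ (Fin n) → ℝ} (hφ : IsLP φ) (q : ℤ) :
    𝓢(EuclideanSpace ℝ (Fin n), ℂ) :=
  HasCompactSupport.toSchwartzMap (f := fun ξ => (φ ((2:ℝ)^(-q) • ξ) : ℂ))
    (by
      refine HasCompactSupport.of_support_subset_isCompact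
        (isCompact_closedBall (0 : EuclideanSpace ℝ (Fin n)) ((2:ℝ) ^ q * (8/3))) fun ξ hξ => ?_
      have h := (hφ.supp _ (by simpa using hξ)).2
      rw [norm_smul, norm_inv, norm_zpow, Real.norm_ofNat, inv_mul_le_iff₀ (by positivity)] at h
      simpa using h)
    (Complex.ofRealCLM.contDiff.comp (hφ.smooth.comp (contDiff_const_smul _)))

variable {φ : EuclideanSpace ℝ (Fin n) → ℝ} (hφ : IsLP φ)

@[simp]
theorem lpSymbol_apply (q : ℤ) (ξ : EuclideanSpace ℝ (Fin n)) :
    lpSymbol hφ q ξ = (φ ((2:ℝ)^(-q) • ξ) : ℂ) := rfl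

/-- The convolution kernel of the Littlewood–Paley block of index `q`. -/
def lpKernel (q : ℤ) : 𝓢(EuclideanSpace ℝ (Fin n), ℂ) := 𝓕⁻ (lpSymbol hφ q)

/-- The pointwise product of two Schwartz functions. -/
def schwartzMul (f g : 𝓢(EuclideanSpace ℝ (Fin n), ℂ)) : 𝓢(EuclideanSpace ℝ (Fin n), ℂ) :=
  SchwartzMap.pairing (ContinuousLinearMap.mul ℂ ℂ) f g

@[simp]
theorem schwartzMul_apply (f g : 𝓢(EuclideanSpace ℝ (Fin n), ℂ)) (x : EuclideanSpace ℝ (Fin n)) :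
    schwartzMul f g x = f x * g x := by
  simp [schwartzMul]

/-- The Littlewood–Paley block of index `q`, as an operator on Schwartz functions. -/
def lpBlock (q : ℤ) (f : 𝓢(EuclideanSpace ℝ (Fin n), ℂ)) : 𝓢(EuclideanSpace ℝ (Fin n), ℂ) :=
  𝓕⁻ (schwartzMul (lpSymbol hφ q) (𝓕 f))

theorem coe_lpBlock (q : ℤ) (f : 𝓢(EuclideanSpace ℝ (Fin n), ℂ)) :
    ⇑(lpBlock hφ q f) = blk φ q f := by
  rw [lpBlock, SchwartzMap.fourierInv_coe, blk]
  congr 1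

theorem fourier_lpBlock_apply (q : ℤ) (f : 𝓢(EuclideanSpace ℝ (Fin n), ℂ))
    (ξ : EuclideanSpace ℝ (Fin n)) :
    𝓕 (lpBlock hφ q f) ξ = φ ((2:ℝ)^(-q) • ξ) * 𝓕 f ξ := by
  simp [lpBlock]

theorem lpBlock_eq_convolution (q : ℤ) (f : 𝓢(EuclideanSpace ℝ (Fin n), ℂ)) :
    lpBlock hφ q f =
      SchwartzMap.convolution (ContinuousLinearMap.mul ℂ ℂ) (lpKernel hφ q) f := by
  simp [lpBlock, SchwartzMap.convolution, schwartzMul, lpKernel]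

theorem lpBlock_apply (q : ℤ) (f : 𝓢(EuclideanSpace ℝ (Fin n), ℂ))
    (x : EuclideanSpace ℝ (Fin n)) :
    lpBlock hφ q f x = ∫ y, lpKernel hφ q (x - y) * f y := by
  rw [lpBlock_eq_convolution, SchwartzMap.convolution_apply, convolution_def,
    ← integral_sub_left_eq_self _ _ x]
  simp

theorem lpKernel_apply (q : ℤ) (x : EuclideanSpace ℝ (Fin n)) :
    lpKernel hφ q x = ((2:ℝ) ^ (q * n) : ℝ) • lpKernel hφ 0 ((2:ℝ) ^ q • x) := by
  have h2 : (2:ℝ) ^ q ≠ 0 := by positivity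
  rw [lpKernel, lpKernel, SchwartzMap.fourierInv_coe, SchwartzMap.fourierInv_coe,
    Real.fourierInv_eq, Real.fourierInv_eq]
  have := Measure.integral_comp_smul (volume : Measure (EuclideanSpace ℝ (Fin n)))
    (fun v => 𝐞 (inner ℝ v ((2:ℝ) ^ q • x)) • lpSymbol hφ 0 v) ((2:ℝ) ^ (-q))
  rw [finrank_euclideanSpace_fin, abs_of_pos (by positivity), zpow_neg, inv_pow, inv_inv,
    ← zpow_natCast, ← zpow_mul] at this
  rw [← this]
  congr 1
  ext v
  simp [inner_smul_left, inner_smul_right, h2]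

/-- Bernstein's inequality: the `L^m → L^l` norm of a Littlewood–Paley block. -/
theorem exists_eLpNorm_lpBlock_le : ∃ C : ℝ≥0∞, C ≠ ∞ ∧ ∀ (q : ℤ)
    (f : 𝓢(EuclideanSpace ℝ (Fin n), ℂ)) (m l : ℝ≥0∞), 1 ≤ m → m ≠ ∞ → m ≤ l →
    eLpNorm (lpBlock hφ q f) l volume ≤
      C * (2:ℝ≥0∞) ^ ((q:ℝ) * n * (m⁻¹.toReal - l⁻¹.toReal)) * eLpNorm f m volume := by
  have hC1 : ∫⁻ y, ‖lpKernel hφ 0 y‖ₑ < ∞ := (lpKernel hφ 0).integrable.hasFiniteIntegral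
  have hC2 : ‖(lpKernel hφ 0).toBoundedContinuousFunction‖ₑ < ∞ := enorm_lt_top
  obtain ⟨C, hC, hC1, hC2⟩ : ∃ C : ℝ≥0∞, C ≠ ∞ ∧ ∫⁻ y, ‖lpKernel hφ 0 y‖ₑ ≤ C ∧
      ∀ y, ‖lpKernel hφ 0 y‖ₑ ≤ C :=
    ⟨_, (max_lt hC1 hC2).ne, le_max_left _ _, fun y => le_max_of_le_right <|
      enorm_le_iff_norm_le.2 ((lpKernel hφ 0).toBoundedContinuousFunction.norm_coe_le_norm y)⟩
  refine ⟨C, hC, fun q f m l hm hm' hl => ?_⟩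
  have h2 : (0:ℝ) < 2 ^ q := by positivity
  have hB : ‖((2:ℝ) ^ (q * n) : ℝ)‖ₑ = (2:ℝ≥0∞) ^ ((q:ℝ) * n) := by
    rw [Real.enorm_of_nonneg (by positivity), ← Real.rpow_intCast,
      ← ENNReal.ofReal_rpow_of_pos (by norm_num)]
    simp
  have hf : eLpNorm f m volume ≠ ∞ := (f.eLpNorm_lt_top m volume).ne
  rw [ENNReal.rpow_mul 2 ((q:ℝ) * n)]
  refine eLpNorm_convolution_le (K := lpKernel hφ q) (h := f) (f := lpBlock hφ q f)
    (B := (2:ℝ≥0∞) ^ ((q:ℝ) * n)) (lpKernel hφ q).continuous f.continuous (fun x => ?_) hC ?_ ?_ ?_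
    (fun x => ?_) hm hm' hl hf
  · rw [lpBlock_apply]
    refine (enorm_integral_le_lintegral_enorm _).trans_eq ?_
    simp
  · exact (ENNReal.rpow_pos (by norm_num) (by norm_num)).ne'
  · exact ENNReal.rpow_ne_top_of_ne_zero (by norm_num) (by norm_num)
  · have h := Measure.integral_comp_smul (volume : Measure (EuclideanSpace ℝ (Fin n)))
      (fun y => ‖lpKernel hφ 0 y‖) ((2:ℝ) ^ q)
    rw [finrank_euclideanSpace_fin, abs_of_pos (by positivity), smul_eq_mul] at h
    have h' : ∫ y, ‖lpKernel hφ q y‖ = ∫ y, ‖lpKernel hφ 0 y‖ := by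
      simp_rw [lpKernel_apply hφ q, norm_smul, integral_const_mul, h, Real.norm_eq_abs]
      rw [abs_of_pos (by positivity), zpow_mul, zpow_natCast,
        mul_inv_cancel_left₀ (by positivity)]
    rwa [← ofReal_integral_norm_eq_lintegral_enorm (lpKernel hφ q).integrable, h',
      ofReal_integral_norm_eq_lintegral_enorm (lpKernel hφ 0).integrable]
  · rw [lpKernel_apply, enorm_smul, hB, mul_comm]
    gcongr
    exact hC2 _

include hφ in
theorem IsLP.norm_bounds {q : ℤ} {ξ : EuclideanSpace ℝ (Fin n)} (h : φ ((2:ℝ)^(-q) • ξ) ≠ 0) :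
    3/4 * (2:ℝ) ^ q ≤ ‖ξ‖ ∧ ‖ξ‖ ≤ 8/3 * (2:ℝ) ^ q := by
  have h2 : (0:ℝ) < 2 ^ q := by positivity
  have h := hφ.supp _ h
  rw [norm_smul, zpow_neg, norm_inv, norm_zpow, Real.norm_ofNat, inv_mul_le_iff₀ h2,
    le_inv_mul_iff₀ h2] at h
  constructor <;> linarith

theorem le_add_of_zpow_le {q r : ℤ} (k : ℕ) {c : ℝ} (hc : c < 2 ^ (k + 1))
    (h : (2:ℝ) ^ r ≤ c * 2 ^ q) : r ≤ q + k := by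
  have h2 : (0:ℝ) < 2 ^ q := by positivity
  have : (2:ℝ) ^ r < 2 ^ (q + (k + 1 : ℕ)) := by
    rw [zpow_add₀ (by norm_num), zpow_natCast]
    nlinarith
  have := (zpow_lt_zpow_iff_right₀ (by norm_num : (1:ℝ) < 2)).1 this
  push_cast at this
  omega

include hφ in
theorem IsLP.le_add_one {q r : ℤ} {ξ : EuclideanSpace ℝ (Fin n)}
    (hq : φ ((2:ℝ)^(-q) • ξ) ≠ 0) (hr : φ ((2:ℝ)^(-r) • ξ) ≠ 0) : r ≤ q + 1 := by
  have h1 := (hφ.norm_bounds hq).2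
  have h2 := (hφ.norm_bounds hr).1
  exact le_add_of_zpow_le 1 (c := 32/9) (by norm_num) (by linarith)

include hφ in
theorem IsLP.exists_tsum_enorm_le : ∃ C : ℝ≥0∞, C ≠ ∞ ∧ ∀ ξ : EuclideanSpace ℝ (Fin n),
    ∑' q : ℤ, ‖φ ((2:ℝ)^(-q) • ξ)‖ₑ ≤ C := by
  have hM : ∀ ξ, ‖φ ξ‖ₑ ≤ ‖(lpSymbol hφ 0).toBoundedContinuousFunction‖ₑ := fun ξ => by
    have := (lpSymbol hφ 0).toBoundedContinuousFunction.norm_coe_le_norm ξ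
    refine enorm_le_iff_norm_le.2 (le_trans ?_ this)
    simp
  refine ⟨∑ k ∈ Finset.Icc (-1 : ℤ) 1, ‖(lpSymbol hφ 0).toBoundedContinuousFunction‖ₑ,
    by simp [ENNReal.mul_eq_top], fun ξ => ?_⟩
  by_cases h : ∀ q : ℤ, φ ((2:ℝ)^(-q) • ξ) = 0
  · simp only [h, enorm_zero, tsum_zero]
    positivity
  push Not at h
  obtain ⟨q₀, hq₀⟩ := h
  rw [← (Equiv.addRight q₀).tsum_eq, tsum_eq_sum (s := Finset.Icc (-1 : ℤ) 1)]
  · exact Finset.sum_le_sum fun _ _ => hM _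
  · intro k hk
    by_contra hne
    refine hk ?_
    have hne : φ ((2:ℝ)^(-(k + q₀)) • ξ) ≠ 0 := by simpa using hne
    have h1 := hφ.le_add_one hq₀ hne
    have h2 := hφ.le_add_one hne hq₀
    rw [Finset.mem_Icc]
    omega

include hφ in
theorem summable_integral_norm_mul_fourier (f : 𝓢(EuclideanSpace ℝ (Fin n), ℂ)) :
    Summable (fun q : ℤ => ∫ v, ‖(φ ((2:ℝ)^(-q) • v) : ℂ) * 𝓕 f v‖) := by
  obtain ⟨C, hC, h⟩ := hφ.exists_tsum_enorm_le
  have hI : ∀ q : ℤ, Integrable fun v => (φ ((2:ℝ)^(-q) • v) : ℂ) * 𝓕 f v := fun q =>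
    (schwartzMul (lpSymbol hφ q) (𝓕 f)).integrable.congr (.of_forall fun v => by simp)
  have hf : ∫⁻ v, ‖𝓕 f v‖ₑ ≠ ∞ := (𝓕 f).integrable.hasFiniteIntegral.ne
  have : ∑' q : ℤ, ∫⁻ v, ‖(φ ((2:ℝ)^(-q) • v) : ℂ) * 𝓕 f v‖ₑ ≠ ∞ := by
    rw [← lintegral_tsum fun q => (hI q).aestronglyMeasurable.enorm]
    refine ne_top_of_le_ne_top (ENNReal.mul_ne_top hC hf) ?_
    rw [← lintegral_const_mul' _ _ hC]
    refine lintegral_mono fun v => ?_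
    simp_rw [enorm_mul, ENNReal.tsum_mul_right]
    gcongr
    refine le_trans (ENNReal.tsum_le_tsum fun q => ?_) (h v)
    exact enorm_le_iff_norm_le.2 (by simp)
  refine (ENNReal.summable_toReal this).congr fun q => ?_
  rw [integral_norm_eq_lintegral_enorm (hI q).aestronglyMeasurable]

theorem lpBlock_apply_eq_integral_fourier (q : ℤ) (f : 𝓢(EuclideanSpace ℝ (Fin n), ℂ))
    (x : EuclideanSpace ℝ (Fin n)) :
    lpBlock hφ q f x = ∫ v, 𝐞 (inner ℝ v x) • ((φ ((2:ℝ)^(-q) • v) : ℂ) * 𝓕 f v) := by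
  rw [coe_lpBlock, blk, Real.fourierInv_eq]
  rfl

theorem norm_lpBlock_apply_le (q : ℤ) (f : 𝓢(EuclideanSpace ℝ (Fin n), ℂ))
    (x : EuclideanSpace ℝ (Fin n)) :
    ‖lpBlock hφ q f x‖ ≤ ∫ v, ‖(φ ((2:ℝ)^(-q) • v) : ℂ) * 𝓕 f v‖ := by
  rw [lpBlock_apply_eq_integral_fourier]
  refine (norm_integral_le_integral_norm _).trans_eq ?_
  simp only [Circle.norm_smul]

theorem hasSum_lpBlock (hn : 0 < n) (f : 𝓢(EuclideanSpace ℝ (Fin n), ℂ))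
    (x : EuclideanSpace ℝ (Fin n)) : HasSum (fun q => lpBlock hφ q f x) (f x) := by
  have : Nonempty (Fin n) := ⟨⟨0, hn⟩⟩
  have : Nontrivial (EuclideanSpace ℝ (Fin n)) := inferInstance
  have h := hasSum_integral_of_summable_integral_norm (μ := volume)
    (F := fun (q : ℤ) v => 𝐞 (inner ℝ v x) • ((φ ((2:ℝ)^(-q) • v) : ℂ) * 𝓕 f v))
    (fun q => ?_) ?_
  · simp_rw [← lpBlock_apply_eq_integral_fourier hφ] at h
    convert! h using 1
    have hf : f x = 𝓕⁻ (𝓕 f) x := by simp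
    rw [hf, SchwartzMap.fourierInv_coe, Real.fourierInv_eq]
    refine integral_congr_ae ?_
    filter_upwards [compl_mem_ae_iff.2 (measure_singleton (μ := volume)
      (0 : EuclideanSpace ℝ (Fin n)))] with v hv
    have hs : HasSum (fun q : ℤ => (φ ((2:ℝ)^(-q) • v) : ℂ)) 1 := by
      simpa using (Complex.hasSum_ofReal.2 (hφ.sum v hv))
    simpa using ((hs.mul_right (𝓕 f v)).const_smul (𝐞 (inner ℝ v x))).tsum_eq.symm
  · have hI := (schwartzMul (lpSymbol hφ q) (𝓕 f)).integrable (μ := volume)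
    have := (Real.fourierIntegral_convergent_iff (V := EuclideanSpace ℝ (Fin n)) (-x)).2 hI
    simpa using this
  · simpa only [Circle.norm_smul] using summable_integral_norm_mul_fourier hφ f

theorem hasSum_lpBlock_schwartzMul (hn : 0 < n) (j : ℤ)
    (f g : 𝓢(EuclideanSpace ℝ (Fin n), ℂ)) (x : EuclideanSpace ℝ (Fin n)) :
    HasSum (fun i : ℤ × ℤ => lpBlock hφ j (schwartzMul (lpBlock hφ i.1 f) (lpBlock hφ i.2 g)) x)
      (lpBlock hφ j (schwartzMul f g) x) := by
  set N : 𝓢(EuclideanSpace ℝ (Fin n), ℂ) → ℤ → ℝ :=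
    fun h q => ∫ v, ‖(φ ((2:ℝ)^(-q) • v) : ℂ) * 𝓕 h v‖ with hN
  have hN0 : ∀ h q, 0 ≤ N h q := fun h q => integral_nonneg fun v => norm_nonneg _
  have hNs : ∀ h, Summable (N h) := summable_integral_norm_mul_fourier hφ
  have hNle : ∀ h q y, ‖lpBlock hφ q h y‖ ≤ N h q := fun h q y => norm_lpBlock_apply_le hφ q h y
  have hNN : Summable fun i : ℤ × ℤ => N f i.1 * N g i.2 :=
    (hNs f).mul_of_nonneg (hNs g) (hN0 f) (hN0 g)
  have hK : Integrable fun y => lpKernel hφ j (x - y) :=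
    (lpKernel hφ j).integrable.comp_sub_left x
  have hbound : ∀ (i : ℤ × ℤ) y, ‖lpKernel hφ j (x - y) *
      schwartzMul (lpBlock hφ i.1 f) (lpBlock hφ i.2 g) y‖ ≤
      N f i.1 * N g i.2 * ‖lpKernel hφ j (x - y)‖ := fun i y => by
    rw [norm_mul, mul_comm, schwartzMul_apply, norm_mul]
    gcongr
    · exact hNle _ _ _
    · exact hNle _ _ _
  have hI : ∀ i : ℤ × ℤ, Integrable fun y => lpKernel hφ j (x - y) *
      schwartzMul (lpBlock hφ i.1 f) (lpBlock hφ i.2 g) y := fun i =>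
    (hK.norm.const_mul _).mono' (by
      refine hK.aestronglyMeasurable.mul ?_
      exact (SchwartzMap.continuous _).aestronglyMeasurable) (.of_forall (hbound i))
  have h := hasSum_integral_of_summable_integral_norm hI ?_
  · simp_rw [← lpBlock_apply hφ] at h
    convert! h using 1
    rw [lpBlock_apply]
    congr 1
    ext y
    rw [tsum_mul_left]
    congr 1
    simp_rw [schwartzMul_apply]
    refine (HasSum.mul (hasSum_lpBlock hφ hn f y) (hasSum_lpBlock hφ hn g y) ?_).tsum_eq.symm
    refine Summable.of_norm_bounded hNN fun i => ?_
    rw [norm_mul]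
    gcongr
    · exact hNle _ _ _
    · exact hNle _ _ _
  · refine Summable.of_nonneg_of_le (fun i => integral_nonneg fun y => norm_nonneg _) (fun i => ?_)
      (hNN.mul_right (∫ y, ‖lpKernel hφ j (x - y)‖))
    rw [← integral_const_mul]
    exact integral_mono (hI i).norm (hK.norm.const_mul _) (hbound i)

theorem eLpNorm_lpBlock_schwartzMul_le (hn : 0 < n) (j : ℤ) {p : ℝ≥0∞} (hp : 1 ≤ p)
    (f g : 𝓢(EuclideanSpace ℝ (Fin n), ℂ)) :
    eLpNorm (lpBlock hφ j (schwartzMul f g)) p volume ≤ ∑' (q : ℤ) (r : ℤ),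
      eLpNorm (lpBlock hφ j (schwartzMul (lpBlock hφ q f) (lpBlock hφ r g))) p volume := by
  refine (eLpNorm_le_tsum_of_hasSum hp (fun i : ℤ × ℤ => ?_)
    (hasSum_lpBlock_schwartzMul hφ hn j f g)).trans_eq ENNReal.tsum_prod'
  exact (SchwartzMap.continuous _).aestronglyMeasurable

theorem lpBlock_eq_zero {k : ℤ} {h : 𝓢(EuclideanSpace ℝ (Fin n), ℂ)}
    (H : ∀ ξ, φ ((2:ℝ)^(-k) • ξ) ≠ 0 → 𝓕 h ξ = 0) : lpBlock hφ k h = 0 := by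
  ext x
  rw [lpBlock_apply_eq_integral_fourier]
  refine integral_eq_zero_of_ae (.of_forall fun ξ => ?_)
  by_cases hξ : φ ((2:ℝ)^(-k) • ξ) = 0
  · simp only [hξ]; simp
  · simp [H ξ hξ]

theorem lpBlock_lpBlock_eq_sum (hn : 0 < n) (q : ℤ) (f : 𝓢(EuclideanSpace ℝ (Fin n), ℂ)) :
    ⇑(lpBlock hφ q f) = ∑ k ∈ Finset.Icc (q - 1) (q + 1), ⇑(lpBlock hφ k (lpBlock hφ q f)) := by
  ext x
  rw [Finset.sum_apply]
  refine (hasSum_lpBlock hφ hn (lpBlock hφ q f) x).unique (hasSum_sum_of_ne_finset_zero ?_)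
  intro k hk
  rw [lpBlock_eq_zero hφ, zero_apply]
  intro ξ hξ
  rw [fourier_lpBlock_apply]
  by_contra hne
  have hne : φ ((2:ℝ)^(-q) • ξ) ≠ 0 := fun h0 => hne (by rw [h0]; simp)
  have h1 := hφ.le_add_one hξ hne
  have h2 := hφ.le_add_one hne hξ
  refine hk ?_
  rw [Finset.mem_Icc]
  omega

/-- The frequency support of a product lies in the sum of the frequency supports. -/
theorem exists_add_of_lpBlock_schwartzMul_ne_zero {j : ℤ} {u v : 𝓢(EuclideanSpace ℝ (Fin n), ℂ)}
    (H : lpBlock hφ j (schwartzMul u v) ≠ 0) :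
    ∃ ξ η, φ ((2:ℝ)^(-j) • (ξ + η)) ≠ 0 ∧ 𝓕 u ξ ≠ 0 ∧ 𝓕 v η ≠ 0 := by
  by_contra! hcon
  refine H (lpBlock_eq_zero hφ fun ξ hξ => ?_)
  have hneg : ∀ (h : 𝓢(EuclideanSpace ℝ (Fin n), ℂ)) (t : EuclideanSpace ℝ (Fin n)),
      𝓕⁻ h t = 𝓕 h (-t) := fun h t => by
    rw [SchwartzMap.fourierInv_coe, SchwartzMap.fourier_coe, Real.fourierInv_eq_fourier_neg]
  have hconv : 𝓕⁻ (schwartzMul u v) =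
      SchwartzMap.convolution (ContinuousLinearMap.mul ℂ ℂ) (𝓕⁻ u) (𝓕⁻ v) := by
    simp [SchwartzMap.convolution, schwartzMul]
  rw [← neg_neg ξ, ← hneg, hconv, SchwartzMap.convolution_apply, convolution_def]
  refine integral_eq_zero_of_ae (.of_forall fun t => ?_)
  simp only [hneg, ContinuousLinearMap.mul_apply', Pi.zero_apply, mul_eq_zero]
  by_contra! hne
  exact hne.2 (hcon (-t) (-(-ξ - t)) (by simpa using hξ) hne.1)

theorem lpBlock_schwartzMul_lpBlock_index_le {j q r : ℤ} (hqr : q ≤ r)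
    {f g : 𝓢(EuclideanSpace ℝ (Fin n), ℂ)}
    (H : lpBlock hφ j (schwartzMul (lpBlock hφ q f) (lpBlock hφ r g)) ≠ 0) :
    j ≤ r + 6 ∧ (q + 3 ≤ r → r ≤ j + 6) := by
  obtain ⟨ξ, η, h1, h2, h3⟩ := exists_add_of_lpBlock_schwartzMul_ne_zero hφ H
  rw [fourier_lpBlock_apply] at h2 h3
  have h1 := hφ.norm_bounds h1
  have h2 := hφ.norm_bounds (q := q) (ξ := ξ) fun h0 => h2 (by rw [h0]; simp)
  have h3 := hφ.norm_bounds (q := r) (ξ := η) fun h0 => h3 (by rw [h0]; simp)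
  have h4 := norm_add_le ξ η
  have h5 : ‖η‖ ≤ ‖ξ + η‖ + ‖ξ‖ := by simpa using norm_sub_le (ξ + η) ξ
  have hq : (2:ℝ) ^ q ≤ 2 ^ r := zpow_le_zpow_right₀ (by norm_num) hqr
  constructor
  · exact le_add_of_zpow_le 6 (c := 64/9) (by norm_num) (by linarith)
  · intro h6
    have h7 : (2:ℝ) ^ q * 8 ≤ 2 ^ r := by
      have := zpow_le_zpow_right₀ (by norm_num : (1:ℝ) ≤ 2) h6
      rw [zpow_add₀ (by norm_num)] at this
      norm_num at this
      exact this
    exact le_add_of_zpow_le 6 (c := 32/5) (by norm_num) (by linarith)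

theorem two_rpow_add (x y : ℝ) : (2:ℝ≥0∞) ^ (x + y) = 2 ^ x * 2 ^ y :=
  ENNReal.rpow_add _ _ (by norm_num) (by norm_num)

theorem two_rpow_ne_top (x : ℝ) : (2:ℝ≥0∞) ^ x ≠ ∞ :=
  ENNReal.rpow_ne_top_of_ne_zero (by norm_num) (by norm_num)

theorem two_rpow_le {x y : ℝ} (h : x ≤ y) : (2:ℝ≥0∞) ^ x ≤ 2 ^ y :=
  ENNReal.rpow_le_rpow_of_exponent_le (by norm_num) h

/-- Bernstein's inequality for Littlewood–Paley blocks. -/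
theorem exists_eLpNorm_lpBlock_le_self (hn : 0 < n) {p l : ℝ≥0∞} (hp1 : 1 ≤ p) (hptop : p ≠ ∞)
    (hpl : p ≤ l) : ∃ C : ℝ≥0∞, C ≠ ∞ ∧ ∀ (q : ℤ) (f : 𝓢(EuclideanSpace ℝ (Fin n), ℂ)),
      eLpNorm (lpBlock hφ q f) l volume ≤
        C * 2 ^ ((q:ℝ) * n * (p⁻¹.toReal - l⁻¹.toReal)) * eLpNorm (lpBlock hφ q f) p volume := by
  obtain ⟨C, hC, h⟩ := exists_eLpNorm_lpBlock_le hφ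
  set δ := p⁻¹.toReal - l⁻¹.toReal with hδ
  have hδ0 : 0 ≤ δ := sub_nonneg.2 <| ENNReal.toReal_mono
    (ENNReal.inv_ne_top.2 (zero_lt_one.trans_le hp1).ne') (ENNReal.inv_le_inv.2 hpl)
  refine ⟨3 * (C * 2 ^ (n * δ)), ENNReal.mul_ne_top (by norm_num)
    (ENNReal.mul_ne_top hC (two_rpow_ne_top _)), fun q f => ?_⟩
  conv_lhs => rw [lpBlock_lpBlock_eq_sum hφ hn q f]
  refine (eLpNorm_sum_le (fun k _ => (SchwartzMap.continuous _).aestronglyMeasurable)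
    (hp1.trans hpl)).trans ?_
  refine (Finset.sum_le_card_nsmul _ _ (C * 2 ^ (n * δ) * 2 ^ ((q:ℝ) * n * δ) *
    eLpNorm (lpBlock hφ q f) p volume) fun k hk => ?_).trans_eq ?_
  · refine (h k _ p l hp1 hptop hpl).trans ?_
    rw [mul_assoc C (2 ^ (n * δ)), ← two_rpow_add]
    gcongr 2
    refine two_rpow_le ?_
    have hk : (k:ℝ) ≤ q + 1 := by exact_mod_cast (Finset.mem_Icc.1 hk).2
    have : 0 ≤ n * δ := by positivity
    nlinarith
  · have : (Finset.Icc (q - 1) (q + 1)).card = 3 := by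
      rw [Int.card_Icc]
      ring_nf
      rfl
    rw [this, nsmul_eq_mul]
    push_cast
    ring

theorem eLpNorm_schwartzMul_le {l p m : ℝ≥0∞} [HolderTriple l p m]
    (f g : 𝓢(EuclideanSpace ℝ (Fin n), ℂ)) :
    eLpNorm (schwartzMul f g) m volume ≤ eLpNorm f l volume * eLpNorm g p volume := by
  have h : ⇑(schwartzMul f g) = ⇑f • ⇑g := by
    ext x
    simp
  rw [h]
  exact eLpNorm_smul_le_mul_eLpNorm g.continuous.aestronglyMeasurable
    f.continuous.aestronglyMeasurable

theorem exists_eLpNorm_lpBlock_schwartzMul_le (hn : 0 < n) {p l m : ℝ≥0∞} [HolderTriple l p m]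
    (hp1 : 1 ≤ p) (hptop : p ≠ ∞) (hpl : p ≤ l) (hm1 : 1 ≤ m) :
    ∃ C : ℝ≥0∞, C ≠ ∞ ∧ ∀ (j q r : ℤ) (f g : 𝓢(EuclideanSpace ℝ (Fin n), ℂ)),
      eLpNorm (lpBlock hφ j (schwartzMul (lpBlock hφ q f) (lpBlock hφ r g))) p volume ≤
        2 ^ (j * (n * l⁻¹.toReal) + q * (n * p⁻¹.toReal - n * l⁻¹.toReal)) *
          (C * (eLpNorm (lpBlock hφ q f) p volume * eLpNorm (lpBlock hφ r g) p volume)) := by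
  obtain ⟨C, hC, h⟩ := exists_eLpNorm_lpBlock_le hφ
  obtain ⟨C', hC', h'⟩ := exists_eLpNorm_lpBlock_le_self hφ hn hp1 hptop hpl
  have hinv : l⁻¹ + p⁻¹ = m⁻¹ := HolderTriple.inv_add_inv_eq_inv l p m
  have hmp : m ≤ p := ENNReal.inv_le_inv.1 (hinv ▸ le_add_self)
  have hp0 := (zero_lt_one.trans_le hp1).ne'
  have hl0 := (zero_lt_one.trans_le (hp1.trans hpl)).ne'
  have hreal : m⁻¹.toReal - p⁻¹.toReal = l⁻¹.toReal := by
    rw [← hinv, ENNReal.toReal_add (ENNReal.inv_ne_top.2 hl0) (ENNReal.inv_ne_top.2 hp0)]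
    ring
  refine ⟨C * C', ENNReal.mul_ne_top hC hC', fun j q r f g => ?_⟩
  calc eLpNorm (lpBlock hφ j (schwartzMul (lpBlock hφ q f) (lpBlock hφ r g))) p volume
      ≤ _ := h j _ m p hm1 (ne_top_of_le_ne_top hptop hmp) hmp
    _ ≤ C * 2 ^ ((j:ℝ) * n * l⁻¹.toReal) *
        (eLpNorm (lpBlock hφ q f) l volume * eLpNorm (lpBlock hφ r g) p volume) := by
      rw [hreal]
      gcongr
      exact eLpNorm_schwartzMul_le _ _
    _ ≤ C * 2 ^ ((j:ℝ) * n * l⁻¹.toReal) *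
        (C' * 2 ^ ((q:ℝ) * n * (p⁻¹.toReal - l⁻¹.toReal)) * eLpNorm (lpBlock hφ q f) p volume *
          eLpNorm (lpBlock hφ r g) p volume) := by
      gcongr
      exact h' q f
    _ = _ := by
      rw [two_rpow_add, ← mul_assoc (j:ℝ), ← mul_sub, ← mul_assoc (q:ℝ)]
      ring

theorem exists_tsum_two_rpow_le {δ : ℝ} (hδ : 0 < δ) : ∃ C : ℝ≥0∞, C ≠ ∞ ∧ ∀ r : ℤ,
    ∑' j : ℤ, (if j ≤ r + 6 then (2:ℝ≥0∞) ^ (j * δ) else 0) ≤ C * 2 ^ (r * δ) := by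
  refine ⟨2 ^ (6 * δ) * (1 - 2 ^ (-δ))⁻¹, ?_, fun r => ?_⟩
  · refine ENNReal.mul_ne_top (two_rpow_ne_top _) (ENNReal.inv_ne_top.2 ?_)
    exact (tsub_pos_of_lt (ENNReal.rpow_lt_one_of_one_lt_of_neg (by norm_num) (by linarith))).ne'
  rw [← ((Equiv.neg ℤ).trans (Equiv.addRight (r + 6))).tsum_eq]
  have hinj : Function.Injective (fun k : ℕ => (k : ℤ)) := Nat.cast_injective
  rw [← hinj.tsum_eq]
  · rw [← ENNReal.tsum_geometric, ← ENNReal.tsum_mul_left, ← ENNReal.tsum_mul_right]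
    refine (tsum_congr fun k => ?_).le
    rw [if_pos (by simp), ← ENNReal.rpow_natCast, ← ENNReal.rpow_mul, ← two_rpow_add,
      ← two_rpow_add]
    congr 1
    simp
    ring
  · intro j hj
    simp only [Function.mem_support, Equiv.trans_apply, Equiv.neg_apply, Equiv.coe_addRight,
      ne_eq, ite_eq_right_iff, Classical.not_imp] at hj
    exact ⟨j.toNat, by dsimp only; omega⟩

theorem exists_tsum_two_rpow_mul_le {σ θ : ℝ} (h : 0 < σ + θ) : ∃ C : ℝ≥0∞, C ≠ ∞ ∧
    ∀ (r : ℤ) (e : ℝ) (A : ℝ≥0∞) (T : ℤ → ℝ≥0∞), (∀ j, T j ≤ 2 ^ (j * θ + e) * A) →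
      (∀ j, r + 6 < j → T j = 0) →
      ∑' j : ℤ, 2 ^ (j * σ) * T j ≤ C * 2 ^ (r * (σ + θ) + e) * A := by
  obtain ⟨C, hC, hsum⟩ := exists_tsum_two_rpow_le h
  refine ⟨C, hC, fun r e A T hT hT0 => ?_⟩
  calc ∑' j : ℤ, 2 ^ (j * σ) * T j
      ≤ ∑' j : ℤ, (if j ≤ r + 6 then (2:ℝ≥0∞) ^ (j * (σ + θ)) else 0) * (2 ^ e * A) := by
        refine ENNReal.tsum_le_tsum fun j => ?_
        split_ifs with hj
        · calc 2 ^ (j * σ) * T j ≤ 2 ^ (j * σ) * (2 ^ (j * θ + e) * A) := by gcongr; exact hT j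
            _ = _ := by rw [two_rpow_add, mul_add, two_rpow_add]; ring
        · simp [hT0 j (not_le.1 hj)]
    _ ≤ C * 2 ^ (r * (σ + θ)) * (2 ^ e * A) := by
        rw [ENNReal.tsum_mul_right]
        gcongr
        exact hsum r
    _ = _ := by rw [two_rpow_add]; ring

theorem exists_tsum_eLpNorm_lpBlock_schwartzMul_le (hn : 0 < n) {p : ℝ≥0∞} (hp1 : 1 ≤ p)
    (hptop : p ≠ ∞) {s₁ s₂ : ℝ} (hs₁ : s₁ ≤ n * p⁻¹.toReal)
    (hsum : n * max 0 (2 * p⁻¹.toReal - 1) < s₁ + s₂) :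
    ∃ C : ℝ≥0∞, C ≠ ∞ ∧ ∀ (q r : ℤ), q ≤ r → ∀ f g : 𝓢(EuclideanSpace ℝ (Fin n), ℂ),
      ∑' j : ℤ, 2 ^ (j * (s₁ + s₂ - n * p⁻¹.toReal)) *
        eLpNorm (lpBlock hφ j (schwartzMul (lpBlock hφ q f) (lpBlock hφ r g))) p volume ≤
      C * (2 ^ (q * s₁ + r * s₂) *
        (eLpNorm (lpBlock hφ q f) p volume * eLpNorm (lpBlock hφ r g) p volume)) := by
  have hp0 := (zero_lt_one.trans_le hp1).ne'
  have hpinv1 : p⁻¹ ≤ 1 := ENNReal.inv_le_one.2 hp1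
  set l : ℝ≥0∞ := (min p⁻¹ (1 - p⁻¹))⁻¹ with hl
  set m : ℝ≥0∞ := (l⁻¹ + p⁻¹)⁻¹ with hm
  have hlinv : l⁻¹ = min p⁻¹ (1 - p⁻¹) := by rw [hl, inv_inv]
  have : HolderTriple l p m := ⟨by rw [hm]; exact (inv_inv _).symm⟩
  have hpl : p ≤ l := ENNReal.inv_le_inv.1 (hlinv ▸ min_le_left _ _)
  have hm1 : 1 ≤ m := by
    rw [hm, ENNReal.one_le_inv, hlinv]
    calc min p⁻¹ (1 - p⁻¹) + p⁻¹ ≤ 1 - p⁻¹ + p⁻¹ := by gcongr; exact min_le_right _ _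
      _ = 1 := tsub_add_cancel_of_le hpinv1
  obtain ⟨D, hD, hT⟩ := exists_eLpNorm_lpBlock_schwartzMul_le hφ hn hp1 hptop hpl hm1
  obtain ⟨D', hD', hT'⟩ := exists_eLpNorm_lpBlock_schwartzMul_le hφ hn (l := ∞) (m := p)
    hp1 hptop le_top hp1
  have hlreal : l⁻¹.toReal = min p⁻¹.toReal (1 - p⁻¹.toReal) := by
    rw [hlinv, ENNReal.toReal_min (ENNReal.inv_ne_top.2 hp0) (by finiteness),
      ENNReal.toReal_sub_of_le hpinv1 ENNReal.one_ne_top, ENNReal.toReal_one]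
  set σ : ℝ := s₁ + s₂ - n * p⁻¹.toReal with hσ
  set θ : ℝ := n * l⁻¹.toReal with hθ
  have hσθ : 0 < σ + θ := by
    have : p⁻¹.toReal - min p⁻¹.toReal (1 - p⁻¹.toReal) = max 0 (2 * p⁻¹.toReal - 1) := by
      rcases le_total p⁻¹.toReal (1 - p⁻¹.toReal) with h | h
      · rw [min_eq_left h, max_eq_left (by linarith), sub_self]
      · rw [min_eq_right h, max_eq_right (by linarith)]
        ring
    rw [← this] at hsum
    rw [hσ, hθ, hlreal]
    linarith
  have hσ' : 0 < σ + (|σ| + 1) := by linarith [neg_abs_le σ]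
  obtain ⟨K, hK, hKsum⟩ := exists_tsum_two_rpow_mul_le hσθ
  obtain ⟨K', hK', hKsum'⟩ := exists_tsum_two_rpow_mul_le hσ'
  refine ⟨K * D * 2 ^ (2 * |s₁ - n * p⁻¹.toReal + θ|) + K' * D' * 2 ^ (6 * (|σ| + 1)),
    by finiteness [two_rpow_ne_top (2 * |s₁ - n * p⁻¹.toReal + θ|),
      two_rpow_ne_top (6 * (|σ| + 1))], fun q r hqr f g => ?_⟩
  have hqr' : (q:ℝ) ≤ r := by exact_mod_cast hqr
  have hzero : ∀ j,
      eLpNorm (lpBlock hφ j (schwartzMul (lpBlock hφ q f) (lpBlock hφ r g))) p volume ≠ 0 →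
      j ≤ r + 6 ∧ (q + 3 ≤ r → r ≤ j + 6) := fun j hj =>
    lpBlock_schwartzMul_lpBlock_index_le hφ hqr fun h0 => hj (by rw [h0]; exact eLpNorm_zero)
  set T : ℤ → ℝ≥0∞ := fun j =>
    eLpNorm (lpBlock hφ j (schwartzMul (lpBlock hφ q f) (lpBlock hφ r g))) p volume with hTdef
  set A := eLpNorm (lpBlock hφ q f) p volume * eLpNorm (lpBlock hφ r g) p volume
  have hT0 : ∀ j, r + 6 < j → T j = 0 := fun j hj => by
    by_contra h0
    exact absurd (hzero j h0).1 (not_le.2 hj)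
  rw [add_mul]
  by_cases hlow : q + 3 ≤ r
  · refine le_trans (hKsum' r (q * (n * p⁻¹.toReal) - r * (|σ| + 1) + 6 * (|σ| + 1)) (D' * A) T
      (fun j => ?_) hT0) (le_trans ?_ le_add_self)
    · by_cases h0 : T j = 0
      · rw [h0]
        positivity
      refine (hT' j q r f g).trans ?_
      gcongr ?_ * _
      refine two_rpow_le ?_
      have : (r:ℝ) ≤ j + 6 := by exact_mod_cast (hzero j h0).2 hlow
      simp only [ENNReal.inv_top, ENNReal.toReal_zero]
      nlinarith [abs_nonneg σ]
    · calc K' * 2 ^ (r * (σ + (|σ| + 1)) + (q * (n * p⁻¹.toReal) - r * (|σ| + 1) + 6 * (|σ| + 1)))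
            * (D' * A) ≤ K' * 2 ^ (6 * (|σ| + 1) + (q * s₁ + r * s₂)) * (D' * A) := by
            gcongr _ * ?_ * _
            refine two_rpow_le ?_
            nlinarith
        _ = _ := by rw [two_rpow_add]; ring
  · refine le_trans (hKsum r (q * (n * p⁻¹.toReal - θ)) (D * A) T
      (fun j => hT j q r f g) hT0) (le_trans ?_ le_self_add)
    calc K * 2 ^ (r * (σ + θ) + q * (n * p⁻¹.toReal - θ)) * (D * A)
        ≤ K * 2 ^ (2 * |s₁ - n * p⁻¹.toReal + θ| + (q * s₁ + r * s₂)) * (D * A) := by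
          gcongr _ * ?_ * _
          refine two_rpow_le ?_
          have h2 : (r:ℝ) - q ≤ 2 := by
            have : r - q ≤ 2 := by omega
            exact_mod_cast this
          have : (r - q) * (s₁ - n * p⁻¹.toReal + θ) ≤ 2 * |s₁ - n * p⁻¹.toReal + θ| :=
            (mul_le_mul_of_nonneg_left (le_abs_self _) (sub_nonneg.2 hqr')).trans
              (mul_le_mul_of_nonneg_right h2 (abs_nonneg _))
          rw [hσ]
          linarith
      _ = _ := by rw [two_rpow_add]; ring

theorem schwartzMul_comm (f g : 𝓢(EuclideanSpace ℝ (Fin n), ℂ)) :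
    schwartzMul f g = schwartzMul g f := by
  ext x
  simp [mul_comm]

theorem besov_one_eq (s : ℝ) (p : ℝ≥0∞) (f : EuclideanSpace ℝ (Fin n) → ℂ) :
    besov φ s p 1 f =
      ∑' q : ℤ, 2 ^ (q * s) * ENNReal.ofReal (eLpNorm (blk φ q f) p volume).toReal := by
  rw [besov, lpSeq, eLpNorm_one_eq_lintegral_enorm, lintegral_count]
  refine tsum_congr fun q => ?_
  rw [Real.enorm_of_nonneg (by positivity), ENNReal.ofReal_mul (by positivity),
    ← ENNReal.ofReal_rpow_of_pos (by norm_num), ENNReal.ofReal_ofNat]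

theorem besov_one_coe (s : ℝ) (p : ℝ≥0∞) (f : 𝓢(EuclideanSpace ℝ (Fin n), ℂ)) :
    besov φ s p 1 f = ∑' q : ℤ, 2 ^ (q * s) * eLpNorm (lpBlock hφ q f) p volume := by
  rw [besov_one_eq]
  refine tsum_congr fun q => ?_
  rw [← coe_lpBlock hφ, ENNReal.ofReal_toReal ((lpBlock hφ q f).eLpNorm_lt_top p volume).ne]

end

/-- Moser-type product estimate: for `s₁, s₂ ≤ n/p` with
`s₁ + s₂ > n·max{0, 2/p − 1}`,
`‖fg‖_{Ḃ^{s₁+s₂−n/p}_{p,1}} ≲ ‖f‖_{Ḃ^{s₁}_{p,1}} ‖g‖_{Ḃ^{s₂}_{p,1}}`. -/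
theorem stmt7 (n : ℕ) (hn : 0 < n) (φ : EuclideanSpace ℝ (Fin n) → ℝ)
    (hφ : IsLP φ) (p : ℝ≥0∞) (hp1 : 1 ≤ p) (hptop : p ≠ ∞) (s₁ s₂ : ℝ)
    (hs₁ : s₁ ≤ (n:ℝ) / p.toReal) (hs₂ : s₂ ≤ (n:ℝ) / p.toReal)
    (hsum : (n:ℝ) * max 0 (2 / p.toReal - 1) < s₁ + s₂) :
    ∃ C > (0:ℝ), ∀ f g : 𝓢(EuclideanSpace ℝ (Fin n), ℂ),
      besov φ (s₁ + s₂ - (n:ℝ) / p.toReal) p 1 (fun x => f x * g x)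
        ≤ ENNReal.ofReal C * besov φ s₁ p 1 (⇑f) * besov φ s₂ p 1 (⇑g) := by
  simp only [div_eq_mul_inv, ← ENNReal.toReal_inv] at hs₁ hs₂ hsum ⊢
  obtain ⟨C, hC, h⟩ := exists_tsum_eLpNorm_lpBlock_schwartzMul_le hφ hn hp1 hptop hs₁ hsum
  obtain ⟨C', hC', h'⟩ := exists_tsum_eLpNorm_lpBlock_schwartzMul_le hφ hn hp1 hptop hs₂
    (add_comm s₁ s₂ ▸ hsum)
  have hfin : C + C' + 1 ≠ ∞ := by finiteness
  refine ⟨(C + C' + 1).toReal, ENNReal.toReal_pos (by positivity) hfin, fun f g => ?_⟩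
  rw [ENNReal.ofReal_toReal hfin]
  have hfg : (fun x => f x * g x) = ⇑(schwartzMul f g) := by
    ext x
    simp
  have hblock : ∀ q r : ℤ, ∑' j : ℤ, 2 ^ (j * (s₁ + s₂ - n * p⁻¹.toReal)) *
      eLpNorm (lpBlock hφ j (schwartzMul (lpBlock hφ q f) (lpBlock hφ r g))) p volume ≤
      (C + C' + 1) * ((2 ^ (q * s₁) * eLpNorm (lpBlock hφ q f) p volume) *
        (2 ^ (r * s₂) * eLpNorm (lpBlock hφ r g) p volume)) := fun q r => by
    rcases le_total q r with hqr | hqr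
    · refine (h q r hqr f g).trans ?_
      rw [two_rpow_add, mul_mul_mul_comm]
      gcongr
      exact le_self_add.trans le_self_add
    · simp_rw [schwartzMul_comm (lpBlock hφ q f), add_comm s₁]
      refine (h' r q hqr g f).trans ?_
      rw [two_rpow_add, mul_mul_mul_comm, mul_comm (2 ^ (q * s₁) * _)]
      gcongr
      exact le_add_self.trans le_self_add
  rw [hfg, besov_one_coe hφ, besov_one_coe hφ, besov_one_coe hφ]
  calc ∑' j : ℤ, 2 ^ (j * (s₁ + s₂ - n * p⁻¹.toReal)) *
        eLpNorm (lpBlock hφ j (schwartzMul f g)) p volume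
      ≤ ∑' (j : ℤ) (q : ℤ) (r : ℤ), 2 ^ (j * (s₁ + s₂ - n * p⁻¹.toReal)) *
        eLpNorm (lpBlock hφ j (schwartzMul (lpBlock hφ q f) (lpBlock hφ r g))) p volume := by
        simp_rw [ENNReal.tsum_mul_left]
        gcongr with j
        exact eLpNorm_lpBlock_schwartzMul_le hφ hn j hp1 f g
    _ = ∑' (q : ℤ) (r : ℤ) (j : ℤ), 2 ^ (j * (s₁ + s₂ - n * p⁻¹.toReal)) *
        eLpNorm (lpBlock hφ j (schwartzMul (lpBlock hφ q f) (lpBlock hφ r g))) p volume := by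
        rw [ENNReal.tsum_comm]
        exact tsum_congr fun q => ENNReal.tsum_comm
    _ ≤ ∑' (q : ℤ) (r : ℤ), (C + C' + 1) * ((2 ^ (q * s₁) * eLpNorm (lpBlock hφ q f) p volume) *
        (2 ^ (r * s₂) * eLpNorm (lpBlock hφ r g) p volume)) := by
        gcongr with q r
        exact hblock q r
    _ = _ := by simp_rw [ENNReal.tsum_mul_left, ENNReal.tsum_mul_right, mul_assoc]
end
end
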